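/- arXiv:1203.2696 — 4 statements merged into one kernel-verified Lean document; each statement's English description precedes it below -/
import Mathlib

section
/- Let s ≥ 1 be an integer and 1 ≤ p < ∞ with s·p > 2. There exists a constant C > 0 such that for every smooth function u : ℝ × ℝ² → ℝ and every t ≥ 0, sup_{|x| ≤ 1 + t/2} |u(t,x)| ≤ C (1+t)^{−2/p} Σ_{Γ^k, |k| ≤ s} ‖(Γ^k u)(t,·)‖_{L^p({|x| ≤ 1 + t/2})}, where the sum is over all compositions Γ^k of at most s of the vector fields ∂_t, ∂₁, ∂₂, Ω₁₂, L₀, L₁, L₂. -/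
open MeasureTheory ENNReal

noncomputable section

/-- A point of space-time `ℝ^{1+2}`: `p = (t, x₁, x₂)`. -/
abbrev Pt := ℝ × ℝ × ℝ

/-- The time derivative `∂ₜ`. -/
def vdt (u : Pt → ℝ) : Pt → ℝ := fun p => fderiv ℝ u p ((1:ℝ), (0:ℝ), (0:ℝ))

/-- The spatial derivative `∂₁`. -/
def vd1 (u : Pt → ℝ) : Pt → ℝ := fun p => fderiv ℝ u p ((0:ℝ), (1:ℝ), (0:ℝ))

/-- The spatial derivative `∂₂`. -/
def vd2 (u : Pt → ℝ) : Pt → ℝ := fun p => fderiv ℝ u p ((0:ℝ), (0:ℝ), (1:ℝ))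

/-- The rotation `Ω₁₂ = x₁∂₂ − x₂∂₁`. -/
def vOm (u : Pt → ℝ) : Pt → ℝ := fun p => p.2.1 * vd2 u p - p.2.2 * vd1 u p

/-- The scaling field `L₀ = t∂ₜ + x₁∂₁ + x₂∂₂`. -/
def vL0 (u : Pt → ℝ) : Pt → ℝ := fun p => p.1 * vdt u p + p.2.1 * vd1 u p + p.2.2 * vd2 u p

/-- The Lorentz boost `L₁ = t∂₁ + x₁∂ₜ`. -/
def vL1 (u : Pt → ℝ) : Pt → ℝ := fun p => p.1 * vd1 u p + p.2.1 * vdt u p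

/-- The Lorentz boost `L₂ = t∂₂ + x₂∂ₜ`. -/
def vL2 (u : Pt → ℝ) : Pt → ℝ := fun p => p.1 * vd2 u p + p.2.2 * vdt u p

/-- The wave operator `□ = ∂ₜ² − ∂₁² − ∂₂²`. -/
def box (u : Pt → ℝ) : Pt → ℝ := fun p => vdt (vdt u) p - vd1 (vd1 u) p - vd2 (vd2 u) p

/-- The collection `Γ = (∂ₜ, ∂₁, ∂₂, Ω₁₂, L₀, L₁, L₂)`. -/
def Gfield : Fin 7 → (Pt → ℝ) → Pt → ℝ := ![vdt, vd1, vd2, vOm, vL0, vL1, vL2]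

/-- Composition `Γ^k` of the vector fields indexed by the list `l`. -/
def GComp (l : List (Fin 7)) (u : Pt → ℝ) : Pt → ℝ := l.foldr (fun i v => Gfield i v) u

/-- The norm `‖u(t,·)‖_{Γ,m,L^p}`: the sum, over all compositions of at most `m` of the
vector fields in `Γ`, of the `L^p(ℝ²)` norms of the resulting functions at time `t`. -/
def GammaNorm (m : ℕ) (p : ℝ≥0∞) (u : Pt → ℝ) (t : ℝ) : ℝ≥0∞ :=
  ∑ k ∈ Finset.range (m + 1), ∑ ks : Fin k → Fin 7,
    eLpNorm (fun x : ℝ × ℝ => GComp (List.ofFn ks) u (t, x)) p volume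

lemma smooth_dir {u : Pt → ℝ} (hu : ContDiff ℝ (⊤ : ℕ∞) u) (e : Pt) :
    ContDiff ℝ (⊤ : ℕ∞) (fun q => fderiv ℝ u q e) :=
  (hu.fderiv_right (m := ((⊤ : ℕ∞) : WithTop ℕ∞)) (by simp)).clm_apply contDiff_const

lemma smooth_vdt {u : Pt → ℝ} (hu : ContDiff ℝ (⊤ : ℕ∞) u) : ContDiff ℝ (⊤ : ℕ∞) (vdt u) :=
  smooth_dir hu _

lemma smooth_vd1 {u : Pt → ℝ} (hu : ContDiff ℝ (⊤ : ℕ∞) u) : ContDiff ℝ (⊤ : ℕ∞) (vd1 u) :=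
  smooth_dir hu _

lemma smooth_vd2 {u : Pt → ℝ} (hu : ContDiff ℝ (⊤ : ℕ∞) u) : ContDiff ℝ (⊤ : ℕ∞) (vd2 u) :=
  smooth_dir hu _

lemma smooth_G {u : Pt → ℝ} (hu : ContDiff ℝ (⊤ : ℕ∞) u) (i : Fin 7) :
    ContDiff ℝ (⊤ : ℕ∞) (Gfield i u) := by
  have h0 := smooth_vdt hu
  have h1 := smooth_vd1 hu
  have h2 := smooth_vd2 hu
  fin_cases i
  · exact h0
  · exact h1
  · exact h2
  · show ContDiff ℝ _ (fun p : Pt => p.2.1 * vd2 u p - p.2.2 * vd1 u p)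
    fun_prop
  · show ContDiff ℝ _ (fun p : Pt => p.1 * vdt u p + p.2.1 * vd1 u p + p.2.2 * vd2 u p)
    fun_prop
  · show ContDiff ℝ _ (fun p : Pt => p.1 * vd1 u p + p.2.1 * vdt u p)
    fun_prop
  · show ContDiff ℝ _ (fun p : Pt => p.1 * vd2 u p + p.2.2 * vdt u p)
    fun_prop

lemma smooth_GComp {u : Pt → ℝ} (hu : ContDiff ℝ (⊤ : ℕ∞) u) (l : List (Fin 7)) :
    ContDiff ℝ (⊤ : ℕ∞) (GComp l u) := by
  induction l with
  | nil => exact hu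
  | cons i l ih => exact smooth_G ih i

lemma dir_comm {u : Pt → ℝ} (hu : ContDiff ℝ (⊤ : ℕ∞) u) (e f q : Pt) :
    fderiv ℝ (fun q => fderiv ℝ u q e) q f = fderiv ℝ (fun q => fderiv ℝ u q f) q e := by
  have hd : DifferentiableAt ℝ (fderiv ℝ u) q :=
    ((hu.fderiv_right (m := ((⊤ : ℕ∞) : WithTop ℕ∞)) (by simp)).differentiable (by simp)) q
  have hs : IsSymmSndFDerivAt ℝ u q :=
    (hu.contDiffAt).isSymmSndFDerivAt (by
      rw [minSmoothness_of_isRCLikeNormedField]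
      exact WithTop.coe_le_coe.2 (le_top : (2 : ℕ∞) ≤ ⊤))
  have key : ∀ a : Pt, fderiv ℝ (fun q => fderiv ℝ u q a) q
      = (fderiv ℝ (fderiv ℝ u) q).flip a := by
    intro a
    exact ((hd.hasFDerivAt).clm_apply (hasFDerivAt_const a q)).fderiv.trans (by ext <;> simp)
  rw [key, key]
  simp only [ContinuousLinearMap.flip_apply]
  exact hs.eq f e

lemma dir_mul {v : Pt → ℝ} (hv : ContDiff ℝ (⊤ : ℕ∞) v) (c : Pt →L[ℝ] ℝ) (q e : Pt) :
    fderiv ℝ (fun p => c p * v p) q e = c e * v q + c q * fderiv ℝ v q e := by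
  have hd : DifferentiableAt ℝ v q := (hv.differentiable (by simp)) q
  change fderiv ℝ (⇑c * v) q e = _
  rw [(c.hasFDerivAt.mul hd.hasFDerivAt).fderiv]
  simp
  ring

/-- commuting a constant coefficient derivative with the fields -/
lemma comm_bound {u : Pt → ℝ} (hu : ContDiff ℝ (⊤ : ℕ∞) u) (e : Pt)
    (he : |e.1| ≤ 1 ∧ |e.2.1| + |e.2.2| ≤ 1) (α : Fin 7) (q : Pt) :
    |Gfield α (fun q => fderiv ℝ u q e) q| ≤
      |fderiv ℝ (Gfield α u) q e| + 2 * (|vdt u q| + |vd1 u q| + |vd2 u q|) := by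
  have h0 := smooth_vdt hu
  have h1 := smooth_vd1 hu
  have h2 := smooth_vd2 hu
  have c0 : vdt (fun q => fderiv ℝ u q e) q = fderiv ℝ (vdt u) q e := dir_comm hu _ _ _
  have c1 : vd1 (fun q => fderiv ℝ u q e) q = fderiv ℝ (vd1 u) q e := dir_comm hu _ _ _
  have c2 : vd2 (fun q => fderiv ℝ u q e) q = fderiv ℝ (vd2 u) q e := dir_comm hu _ _ _
  let k0 : Pt →L[ℝ] ℝ := ContinuousLinearMap.fst ℝ ℝ (ℝ × ℝ)
  let k1 : Pt →L[ℝ] ℝ := (ContinuousLinearMap.fst ℝ ℝ ℝ).comp (ContinuousLinearMap.snd ℝ ℝ (ℝ × ℝ))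
  let k2 : Pt →L[ℝ] ℝ := (ContinuousLinearMap.snd ℝ ℝ ℝ).comp (ContinuousLinearMap.snd ℝ ℝ (ℝ × ℝ))
  have m0 : ∀ {v : Pt → ℝ}, ContDiff ℝ (⊤ : ℕ∞) v →
      fderiv ℝ (fun p : Pt => p.1 * v p) q e = e.1 * v q + q.1 * fderiv ℝ v q e :=
    fun hv => dir_mul hv k0 q e
  have m1 : ∀ {v : Pt → ℝ}, ContDiff ℝ (⊤ : ℕ∞) v →
      fderiv ℝ (fun p : Pt => p.2.1 * v p) q e = e.2.1 * v q + q.2.1 * fderiv ℝ v q e :=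
    fun hv => dir_mul hv k1 q e
  have m2 : ∀ {v : Pt → ℝ}, ContDiff ℝ (⊤ : ℕ∞) v →
      fderiv ℝ (fun p : Pt => p.2.2 * v p) q e = e.2.2 * v q + q.2.2 * fderiv ℝ v q e :=
    fun hv => dir_mul hv k2 q e
  have dd : ∀ {v : Pt → ℝ}, ContDiff ℝ (⊤ : ℕ∞) v →
      DifferentiableAt ℝ v q := fun hv => (hv.differentiable (by simp)) q
  have g0 : ∀ {v : Pt → ℝ}, ContDiff ℝ (⊤ : ℕ∞) v →
      DifferentiableAt ℝ (fun p : Pt => p.1 * v p) q := fun hv => dd (by fun_prop)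
  have g1 : ∀ {v : Pt → ℝ}, ContDiff ℝ (⊤ : ℕ∞) v →
      DifferentiableAt ℝ (fun p : Pt => p.2.1 * v p) q := fun hv => dd (by fun_prop)
  have g2 : ∀ {v : Pt → ℝ}, ContDiff ℝ (⊤ : ℕ∞) v →
      DifferentiableAt ℝ (fun p : Pt => p.2.2 * v p) q := fun hv => dd (by fun_prop)
  have e0 := he.1
  have e1 : |e.2.1| ≤ 1 := by linarith [he.2, abs_nonneg e.2.2]
  have e2 : |e.2.2| ≤ 1 := by linarith [he.2, abs_nonneg e.2.1]
  have b : ∀ c x : ℝ, |c| ≤ 1 → |c * x| ≤ |x| := by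
    intro c x hc
    rw [abs_mul]
    exact mul_le_of_le_one_left (abs_nonneg _) hc
  have n0 := abs_nonneg (vdt u q)
  have n1 := abs_nonneg (vd1 u q)
  have n2 := abs_nonneg (vd2 u q)
  -- general principle
  have fin : ∀ X Y Z : ℝ, Y = Z + X → |Z| ≤ 2 * (|vdt u q| + |vd1 u q| + |vd2 u q|) →
      |X| ≤ |Y| + 2 * (|vdt u q| + |vd1 u q| + |vd2 u q|) := by
    intro X Y Z h hZ
    have : X = Y + (-Z) := by linarith
    rw [this]
    refine (abs_add_le _ _).trans ?_
    rw [abs_neg]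
    linarith
  fin_cases α
  · show |vdt (fun q => fderiv ℝ u q e) q| ≤ |fderiv ℝ (vdt u) q e| + _
    rw [c0]; linarith
  · show |vd1 (fun q => fderiv ℝ u q e) q| ≤ |fderiv ℝ (vd1 u) q e| + _
    rw [c1]; linarith
  · show |vd2 (fun q => fderiv ℝ u q e) q| ≤ |fderiv ℝ (vd2 u) q e| + _
    rw [c2]; linarith
  · show |vOm (fun q => fderiv ℝ u q e) q| ≤ |fderiv ℝ (vOm u) q e| + _
    refine fin _ _ (e.2.1 * vd2 u q - e.2.2 * vd1 u q) ?_ ?_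
    · have : fderiv ℝ (vOm u) q e = fderiv ℝ (fun p : Pt => p.2.1 * vd2 u p) q e
          - fderiv ℝ (fun p : Pt => p.2.2 * vd1 u p) q e := by
        have := fderiv_fun_sub (g1 h2) (g2 h1)
        exact congrArg (fun L => L e) this
      rw [this, m1 h2, m2 h1]
      simp only [vOm, c1, c2]
      ring
    · refine (abs_sub _ _).trans ?_
      linarith [b _ (vd2 u q) e1, b _ (vd1 u q) e2]
  · show |vL0 (fun q => fderiv ℝ u q e) q| ≤ |fderiv ℝ (vL0 u) q e| + _
    refine fin _ _ (e.1 * vdt u q + e.2.1 * vd1 u q + e.2.2 * vd2 u q) ?_ ?_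
    · have : fderiv ℝ (vL0 u) q e = fderiv ℝ (fun p : Pt => p.1 * vdt u p) q e
          + fderiv ℝ (fun p : Pt => p.2.1 * vd1 u p) q e
          + fderiv ℝ (fun p : Pt => p.2.2 * vd2 u p) q e := by
        have h := fderiv_fun_add ((g0 h0).fun_add (g1 h1)) (g2 h2)
        rw [fderiv_fun_add (g0 h0) (g1 h1)] at h
        exact congrArg (fun L => L e) h
      rw [this, m0 h0, m1 h1, m2 h2]
      simp only [vL0, c0, c1, c2]
      ring
    · refine (abs_add_three _ _ _).trans ?_
      linarith [b _ (vd2 u q) e2, b _ (vd1 u q) e1, b _ (vdt u q) e0]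
  · show |vL1 (fun q => fderiv ℝ u q e) q| ≤ |fderiv ℝ (vL1 u) q e| + _
    refine fin _ _ (e.1 * vd1 u q + e.2.1 * vdt u q) ?_ ?_
    · have : fderiv ℝ (vL1 u) q e = fderiv ℝ (fun p : Pt => p.1 * vd1 u p) q e
          + fderiv ℝ (fun p : Pt => p.2.1 * vdt u p) q e := by
        have := fderiv_fun_add (g0 h1) (g1 h0)
        exact congrArg (fun L => L e) this
      rw [this, m0 h1, m1 h0]
      simp only [vL1, c1, c0]
      ring
    · refine (abs_add_le _ _).trans ?_
      linarith [b _ (vd1 u q) e0, b _ (vdt u q) e1]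
  · show |vL2 (fun q => fderiv ℝ u q e) q| ≤ |fderiv ℝ (vL2 u) q e| + _
    refine fin _ _ (e.1 * vd2 u q + e.2.2 * vdt u q) ?_ ?_
    · have : fderiv ℝ (vL2 u) q e = fderiv ℝ (fun p : Pt => p.1 * vd2 u p) q e
          + fderiv ℝ (fun p : Pt => p.2.2 * vdt u p) q e := by
        have := fderiv_fun_add (g0 h2) (g2 h0)
        exact congrArg (fun L => L e) this
      rw [this, m0 h2, m2 h0]
      simp only [vL2, c2, c0]
      ring
    · refine (abs_add_le _ _).trans ?_
      linarith [b _ (vd2 u q) e0, b _ (vdt u q) e2]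

/-- first order sum -/
def S1 (u : Pt → ℝ) (q : Pt) : ℝ := ∑ α : Fin 7, |Gfield α u q|

/-- second order sum -/
def S2 (u : Pt → ℝ) (q : Pt) : ℝ := ∑ α : Fin 7, ∑ β : Fin 7, |Gfield β (Gfield α u) q|

lemma S1_nonneg (u : Pt → ℝ) (q : Pt) : 0 ≤ S1 u q := Finset.sum_nonneg fun _ _ => abs_nonneg _

lemma S2_nonneg (u : Pt → ℝ) (q : Pt) : 0 ≤ S2 u q :=
  Finset.sum_nonneg fun _ _ => Finset.sum_nonneg fun _ _ => abs_nonneg _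

lemma first_arith (t x y a b c : ℝ) (ht : 4 ≤ t) (hxy : x ^ 2 + y ^ 2 ≤ (1 + t / 2) ^ 2)
    (L : ℝ) (hL : |t * a + x * b + y * c| + |t * b + x * a| + |t * c + y * a| ≤ L) :
    (1 + t / 2) * |a| ≤ 3 * L ∧ (1 + t / 2) * |b| ≤ 3 * L ∧ (1 + t / 2) * |c| ≤ 3 * L := by
  have hr : x ^ 2 + y ^ 2 ≤ (3 / 4 * t) ^ 2 := hxy.trans (by gcongr; linarith)
  have hx : |x| ≤ 3 / 4 * t := abs_le_of_sq_le_sq (by nlinarith) (by linarith)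
  have hy : |y| ≤ 3 / 4 * t := abs_le_of_sq_le_sq (by nlinarith) (by linarith)
  set L0 := t * a + x * b + y * c
  set L1 := t * b + x * a with hL1
  set L2 := t * c + y * a with hL2
  have h0 := abs_nonneg L0
  have h1 := abs_nonneg L1
  have h2 := abs_nonneg L2
  have ha0 := abs_nonneg a
  have ida : (t ^ 2 - x ^ 2 - y ^ 2) * a = t * L0 - x * L1 - y * L2 := by
    simp only [L0, L1, L2]; ring
  have A : t * |a| ≤ 16 / 7 * L := by
    have e1 : |(t ^ 2 - x ^ 2 - y ^ 2) * a| = (t ^ 2 - x ^ 2 - y ^ 2) * |a| := by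
      rw [abs_mul, abs_of_nonneg]; nlinarith
    have e2 : |t * L0 - x * L1 - y * L2| ≤ t * L := by
      have : |t * L0 - x * L1 - y * L2| ≤ |t * L0| + |x * L1| + |y * L2| :=
        (abs_sub _ _).trans (by gcongr; exact abs_sub _ _)
      refine this.trans ?_
      rw [abs_mul, abs_mul, abs_mul, abs_of_nonneg (show 0 ≤ t by linarith)]
      nlinarith [mul_le_mul_of_nonneg_right hx h1, mul_le_mul_of_nonneg_right hy h2,
        mul_nonneg (show 0 ≤ t by linarith) h1, mul_nonneg (show 0 ≤ t by linarith) h2]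
    rw [← ida, e1] at e2
    have e3 : 7 / 16 * t ^ 2 * |a| ≤ t * L :=
      le_trans (mul_le_mul_of_nonneg_right (by nlinarith) ha0) e2
    have : t * (t * |a|) ≤ t * (16 / 7 * L) := by nlinarith
    exact le_of_mul_le_mul_left this (by linarith)
  have B : ∀ z M d : ℝ, |z| ≤ 3 / 4 * t → M = t * d + z * a → |M| ≤ L → t * |d| ≤ 3 * L := by
    intro z M d hz hM hML
    have : t * d = M - z * a := by linarith
    have h : |t * d| ≤ |M| + |z| * |a| := by
      rw [this, ← abs_mul]; exact abs_sub _ _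
    rw [abs_mul, abs_of_nonneg (show 0 ≤ t by linarith)] at h
    nlinarith [mul_le_mul_of_nonneg_right hz ha0]
  have hR : 1 + t / 2 ≤ t := by linarith
  have hL0 : 0 ≤ L := by linarith
  refine ⟨?_, ?_, ?_⟩
  · exact (mul_le_mul_of_nonneg_right hR ha0).trans (by linarith)
  · exact (mul_le_mul_of_nonneg_right hR (abs_nonneg b)).trans (B x L1 b hx hL1 (by linarith))
  · exact (mul_le_mul_of_nonneg_right hR (abs_nonneg c)).trans (B y L2 c hy hL2 (by linarith))

lemma first_bound (u : Pt → ℝ) (q : Pt) (ht : 0 ≤ q.1)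
    (hq : q.2.1 ^ 2 + q.2.2 ^ 2 ≤ (1 + q.1 / 2) ^ 2) :
    (1 + q.1 / 2) * |vdt u q| ≤ 3 * S1 u q ∧ (1 + q.1 / 2) * |vd1 u q| ≤ 3 * S1 u q
      ∧ (1 + q.1 / 2) * |vd2 u q| ≤ 3 * S1 u q := by
  have hS : S1 u q = |vdt u q| + |vd1 u q| + |vd2 u q| + |vOm u q| + |vL0 u q| + |vL1 u q|
      + |vL2 u q| := by
    simp [S1, Fin.sum_univ_seven, Gfield]
  have n0 := abs_nonneg (vdt u q)
  have n1 := abs_nonneg (vd1 u q)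
  have n2 := abs_nonneg (vd2 u q)
  have n3 := abs_nonneg (vOm u q)
  have n4 := abs_nonneg (vL0 u q)
  have n5 := abs_nonneg (vL1 u q)
  have n6 := abs_nonneg (vL2 u q)
  rcases le_total q.1 4 with h | h
  · have hR : 1 + q.1 / 2 ≤ 3 := by linarith
    rw [hS]
    exact ⟨by nlinarith, by nlinarith, by nlinarith⟩
  · refine first_arith q.1 q.2.1 q.2.2 _ _ _ h hq _ ?_
    rw [hS]
    show |vL0 u q| + |vL1 u q| + |vL2 u q| ≤ _
    linarith

lemma S1_dir {u : Pt → ℝ} (hu : ContDiff ℝ (⊤ : ℕ∞) u) (q : Pt) (ht : 0 ≤ q.1)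
    (hq : q.2.1 ^ 2 + q.2.2 ^ 2 ≤ (1 + q.1 / 2) ^ 2) :
    (1 + q.1 / 2) * S1 (vd1 u) q ≤ 3 * S2 u q + 126 * S1 u q ∧
    (1 + q.1 / 2) * S1 (vd2 u) q ≤ 3 * S2 u q + 126 * S1 u q := by
  have hR : 0 ≤ 1 + q.1 / 2 := by linarith
  have f := first_bound u q ht hq
  have e : 3 * S2 u q + 126 * S1 u q = ∑ α : Fin 7, (3 * S1 (Gfield α u) q + 18 * S1 u q) := by
    rw [Finset.sum_add_distrib, ← Finset.mul_sum]
    simp [S2, S1]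
    ring
  rw [e]
  constructor
  · rw [S1, Finset.mul_sum]
    refine Finset.sum_le_sum fun α _ => ?_
    have g := (first_bound (Gfield α u) q ht hq).2.1
    have c := comm_bound hu ((0:ℝ), (1:ℝ), (0:ℝ)) (by simp) α q
    have := mul_le_mul_of_nonneg_left c hR
    have e1 : (1 + q.1 / 2) * |fderiv ℝ (Gfield α u) q ((0:ℝ), (1:ℝ), (0:ℝ))| ≤ 3 * S1 (Gfield α u) q := g
    refine this.trans ?_
    linarith [f.1, f.2.1, f.2.2]
  · rw [S1, Finset.mul_sum]
    refine Finset.sum_le_sum fun α _ => ?_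
    have g := (first_bound (Gfield α u) q ht hq).2.2
    have c := comm_bound hu ((0:ℝ), (0:ℝ), (1:ℝ)) (by simp) α q
    have := mul_le_mul_of_nonneg_left c hR
    have e1 : (1 + q.1 / 2) * |fderiv ℝ (Gfield α u) q ((0:ℝ), (0:ℝ), (1:ℝ))| ≤ 3 * S1 (Gfield α u) q := g
    refine this.trans ?_
    linarith [f.1, f.2.1, f.2.2]

/-- the disc -/
def Dsc (t : ℝ) : Set (ℝ × ℝ) := {y : ℝ × ℝ | Real.sqrt (y.1 ^ 2 + y.2 ^ 2) ≤ 1 + t / 2}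

/-- unit interval measure -/
def mI : Measure ℝ := volume.restrict (Set.Ioc 0 1)

instance : IsProbabilityMeasure mI := ⟨by simp [mI]⟩

/-- the parallelogram at `x` -/
def par (x v w : ℝ × ℝ) (τ : ℝ) (z : ℝ × ℝ) : ℝ × ℝ :=
  (x.1 + τ * (z.1 * v.1 + z.2 * w.1), x.2 + τ * (z.1 * v.2 + z.2 * w.2))

lemma mem_Dsc {t : ℝ} (ht : 0 ≤ t) (y : ℝ × ℝ) :
    y ∈ Dsc t ↔ y.1 ^ 2 + y.2 ^ 2 ≤ (1 + t / 2) ^ 2 := by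
  show Real.sqrt _ ≤ _ ↔ _
  rw [Real.sqrt_le_left (by linarith)]

lemma exists_vw {t : ℝ} (ht : 0 ≤ t) (x : ℝ × ℝ) (hx : x ∈ Dsc t) :
    ∃ v w : ℝ × ℝ, |v.1| ≤ 1 + t / 2 ∧ |v.2| ≤ 1 + t / 2 ∧ |w.1| ≤ 1 + t / 2 ∧ |w.2| ≤ 1 + t / 2 ∧
      v.1 * w.2 - w.1 * v.2 = (1 + t / 2) ^ 2 / 2 ∧
      ∀ a b : ℝ, 0 ≤ a → a ≤ 1 → 0 ≤ b → b ≤ 1 →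
        (x.1 + (a * v.1 + b * w.1), x.2 + (a * v.2 + b * w.2)) ∈ Dsc t := by
  obtain ⟨R, hR⟩ : ∃ R, R = 1 + t / 2 := ⟨_, rfl⟩
  have hR0 : 0 < R := by linarith
  obtain ⟨r, c, d, hcd, h1, h2, hr0, hrR⟩ : ∃ r c d : ℝ, c ^ 2 + d ^ 2 = 1 ∧ x.1 = r * c ∧
      x.2 = r * d ∧ 0 ≤ r ∧ r ≤ R := by
    have hx' : Real.sqrt (x.1 ^ 2 + x.2 ^ 2) ≤ R := by rw [hR]; exact hx
    rcases (Real.sqrt_nonneg (x.1 ^ 2 + x.2 ^ 2)).eq_or_lt with h | h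
    · have h0 : x.1 ^ 2 + x.2 ^ 2 = 0 := (Real.sqrt_eq_zero (by positivity)).1 h.symm
      refine ⟨0, 1, 0, by norm_num, by nlinarith, by nlinarith, le_rfl, hR0.le⟩
    · set r := Real.sqrt (x.1 ^ 2 + x.2 ^ 2) with hr
      have hr2 : r ^ 2 = x.1 ^ 2 + x.2 ^ 2 := Real.sq_sqrt (by positivity)
      refine ⟨r, x.1 / r, x.2 / r, ?_, by field_simp, by field_simp, h.le, hx'⟩
      field_simp
      exact hr2.symm
  have hc : |c| ≤ 1 := abs_le_of_sq_le_sq (by nlinarith) (by norm_num)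
  have hd : |d| ≤ 1 := abs_le_of_sq_le_sq (by nlinarith) (by norm_num)
  rw [abs_le] at hc hd
  rw [← hR]
  refine ⟨(R / 2 * (-c - d), R / 2 * (c - d)), (R / 2 * (d - c), R / 2 * (-c - d)), ?_, ?_, ?_, ?_, ?_, ?_⟩
  · rw [abs_le]; constructor <;> nlinarith
  · rw [abs_le]; constructor <;> nlinarith
  · rw [abs_le]; constructor <;> nlinarith
  · rw [abs_le]; constructor <;> nlinarith
  · show R / 2 * (-c - d) * (R / 2 * (-c - d)) - R / 2 * (d - c) * (R / 2 * (c - d)) = R ^ 2 / 2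
    linear_combination R ^ 2 / 2 * hcd
  · intro a b ha0 ha1 hb0 hb1
    rw [mem_Dsc ht, ← hR]
    simp only
    rw [h1, h2]
    have e : (r * c + (a * (R / 2 * (-c - d)) + b * (R / 2 * (d - c)))) ^ 2 +
        (r * d + (a * (R / 2 * (c - d)) + b * (R / 2 * (-c - d)))) ^ 2
        = r ^ 2 - r * R * (a + b) + R ^ 2 * (a ^ 2 + b ^ 2) / 2 := by
      linear_combination (r ^ 2 - r * R * (a + b) + R ^ 2 * (a ^ 2 + b ^ 2) / 2) * hcd
    rw [e]
    have i1 : r ^ 2 ≤ r * R := by nlinarith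
    have i2 : R ^ 2 * (a ^ 2 + b ^ 2) ≤ R ^ 2 * (a + b) := by
      gcongr <;> nlinarith
    have i3 : 0 ≤ r * R * (a + b) := by positivity
    have i4 : r * R ≤ R ^ 2 := by nlinarith
    have i5 : 0 ≤ (R ^ 2 - r * R) * (2 - a - b) := mul_nonneg (by linarith) (by linarith)
    nlinarith [mul_nonneg hr0 hR0.le]

lemma par_cont (x v w : ℝ × ℝ) : Continuous (fun p : ℝ × (ℝ × ℝ) => par x v w p.1 p.2) := by
  unfold par; fun_prop

lemma map_par_le {t : ℝ} (ht : 0 ≤ t) (x v w : ℝ × ℝ)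
    (hdet : v.1 * w.2 - w.1 * v.2 = (1 + t / 2) ^ 2 / 2)
    (hmem : ∀ a b : ℝ, 0 ≤ a → a ≤ 1 → 0 ≤ b → b ≤ 1 →
        (x.1 + (a * v.1 + b * w.1), x.2 + (a * v.2 + b * w.2)) ∈ Dsc t)
    (τ : ℝ) (hτ : 0 < τ) (hτ1 : τ ≤ 1) :
    Measure.map (par x v w τ) (mI.prod mI) ≤
      ENNReal.ofReal (8 / (τ ^ 2 * (1 + t) ^ 2)) • (volume.restrict (Dsc t)) := by
  have hD : MeasurableSet (Dsc t) := by
    apply IsClosed.measurableSet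
    exact isClosed_le (by fun_prop) continuous_const
  have hc : Continuous (par x v w τ) := by unfold par; fun_prop
  have hm := hc.measurable
  let A : Matrix (Fin 2) (Fin 2) ℝ := !![τ * v.1, τ * w.1; τ * v.2, τ * w.2]
  let f : (ℝ × ℝ) →ₗ[ℝ] (ℝ × ℝ) := Matrix.toLin (Module.Basis.finTwoProd ℝ) (Module.Basis.finTwoProd ℝ) A
  have hdf : LinearMap.det f = τ ^ 2 * ((1 + t / 2) ^ 2 / 2) := by
    rw [LinearMap.det_toLin, Matrix.det_fin_two_of]
    linear_combination τ ^ 2 * hdet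
  have hpos : 0 < LinearMap.det f := by rw [hdf]; positivity
  have hpar : par x v w τ = (fun y => x + y) ∘ f := by
    funext z
    show _ = x + f z
    rw [show f z = _ from Matrix.toLin_finTwoProd_apply _ _ _ _ z]
    ext <;> simp [par] <;> ring
  have hvol : Measure.map (par x v w τ) volume = ENNReal.ofReal |(LinearMap.det f)⁻¹| • volume := by
    have hfc : Continuous f := f.continuous_of_finiteDimensional
    rw [hpar, ← Measure.map_map (by fun_prop) hfc.measurable,
      Measure.map_linearMap_addHaar_eq_smul_addHaar _ hpos.ne', Measure.map_smul, map_add_left_eq_self]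
  have h1 : mI.prod mI ≤ (volume : Measure (ℝ × ℝ)).restrict ((par x v w τ) ⁻¹' (Dsc t)) := by
    rw [mI, Measure.prod_restrict]
    refine Measure.restrict_mono ?_ le_rfl
    rintro ⟨a, b⟩ ⟨ha, hb⟩
    have ha' : 0 < a ∧ a ≤ 1 := ha
    have hb' : 0 < b ∧ b ≤ 1 := hb
    have := hmem (τ * a) (τ * b) (mul_nonneg hτ.le ha'.1.le) (mul_le_one₀ hτ1 ha'.1.le ha'.2)
      (mul_nonneg hτ.le hb'.1.le) (mul_le_one₀ hτ1 hb'.1.le hb'.2)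
    show par x v w τ (a, b) ∈ Dsc t
    have e : par x v w τ (a, b) = (x.1 + (τ * a * v.1 + τ * b * w.1), x.2 + (τ * a * v.2 + τ * b * w.2)) := by
      ext <;> simp only [par] <;> ring
    rw [e]; exact this
  refine (Measure.map_mono h1 hm).trans ?_
  rw [← Measure.restrict_map hm hD, hvol, Measure.restrict_smul]
  refine Measure.le_iff.2 fun s _ => ?_
  simp only [Measure.smul_apply, smul_eq_mul]
  gcongr
  rw [abs_of_pos (inv_pos.2 hpos), hdf, inv_eq_one_div, div_le_div_iff₀ (by positivity) (by positivity)]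
  have : (1 + t) ^ 2 ≤ 4 * (1 + t / 2) ^ 2 := by nlinarith
  nlinarith [mul_le_mul_of_nonneg_left this (sq_nonneg τ)]

lemma int_par_le {t : ℝ} (ht : 0 ≤ t) (x v w : ℝ × ℝ)
    (hdet : v.1 * w.2 - w.1 * v.2 = (1 + t / 2) ^ 2 / 2)
    (hmem : ∀ a b : ℝ, 0 ≤ a → a ≤ 1 → 0 ≤ b → b ≤ 1 →
        (x.1 + (a * v.1 + b * w.1), x.2 + (a * v.2 + b * w.2)) ∈ Dsc t)
    (p : ℝ) (hp1 : 1 ≤ p)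
    (τ : ℝ) (hτ : 0 < τ) (hτ1 : τ ≤ 1) (g : ℝ × ℝ → ℝ) (hg : Continuous g) :
    ∫⁻ z, ENNReal.ofReal |g (par x v w τ z)| ∂(mI.prod mI) ≤
      ENNReal.ofReal (8 * τ ^ (-(2 / p)) * (1 + t) ^ (-(2 / p))) *
        eLpNorm g (ENNReal.ofReal p) (volume.restrict (Dsc t)) := by
  have hc : Continuous (par x v w τ) := by unfold par; fun_prop
  have hp0 : 0 < p := by linarith
  have h1 : ∫⁻ z, ENNReal.ofReal |g (par x v w τ z)| ∂(mI.prod mI)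
      = eLpNorm (g ∘ par x v w τ) 1 (mI.prod mI) := by
    rw [eLpNorm_one_eq_lintegral_enorm]
    simp only [Real.enorm_eq_ofReal_abs, Function.comp]
  rw [h1]
  refine (eLpNorm_le_eLpNorm_of_exponent_le (q := ENNReal.ofReal p) (by simpa using hp1)
    (hg.comp hc).aestronglyMeasurable).trans ?_
  rw [← eLpNorm_map_measure hg.aestronglyMeasurable hc.aemeasurable]
  refine (eLpNorm_mono_measure _ (map_par_le ht x v w hdet hmem τ hτ hτ1)).trans ?_
  rw [eLpNorm_smul_measure_of_ne_top (by simp), smul_eq_mul]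
  gcongr
  have e : (1 / ENNReal.ofReal p).toReal = 1 / p := by
    rw [ENNReal.toReal_div, ENNReal.toReal_ofReal hp0.le]; simp
  rw [e, ENNReal.ofReal_rpow_of_pos (by positivity)]
  apply ENNReal.ofReal_le_ofReal
  have key : ∀ a : ℝ, 0 < a → (a ^ 2) ^ (1 / p) = (a ^ (-(2 / p)))⁻¹ := by
    intro a ha
    rw [← Real.rpow_natCast a 2, ← Real.rpow_mul ha.le, ← Real.rpow_neg ha.le]
    congr 1
    push_cast; ring
  rw [Real.div_rpow (by norm_num) (by positivity), Real.mul_rpow (by positivity) (by positivity),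
    key τ hτ, key (1 + t) (by linarith)]
  have h8 : (8:ℝ) ^ (1 / p) ≤ 8 := by
    calc (8:ℝ) ^ (1 / p) ≤ 8 ^ (1:ℝ) := by
          apply Real.rpow_le_rpow_of_exponent_le (by norm_num)
          rw [div_le_one hp0]; exact hp1
      _ = 8 := by simp
  rw [div_eq_mul_inv, mul_inv, inv_inv, inv_inv, ← mul_assoc]
  gcongr

lemma line_bound (g g' : ℝ → ℝ) (hg : ∀ x, HasDerivAt g (g' x) x) (hc : Continuous g') (a : ℝ)
    (ha0 : 0 ≤ a) (ha1 : a ≤ 1) :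
    ENNReal.ofReal |g 0| ≤ ENNReal.ofReal |g a| + ∫⁻ τ, ENNReal.ofReal |g' τ| ∂mI := by
  have h := intervalIntegral.integral_eq_sub_of_hasDerivAt (a := 0) (b := a)
    (fun x _ => hg x) (hc.intervalIntegrable _ _)
  have h2 : g 0 = g a - ∫ y in Set.Ioc 0 a, g' y := by
    rw [intervalIntegral.integral_of_le ha0] at h; linarith
  simp only [← Real.enorm_eq_ofReal_abs]
  rw [h2]
  refine enorm_sub_le.trans ?_
  gcongr
  refine (enorm_integral_le_lintegral_enorm _).trans ?_
  rw [mI]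
  exact lintegral_mono_set (Set.Ioc_subset_Ioc_right ha1)

lemma line_bound_avg (g g' : ℝ → ℝ) (hg : ∀ x, HasDerivAt g (g' x) x) (hc : Continuous g') :
    ENNReal.ofReal |g 0| ≤ ∫⁻ τ, (ENNReal.ofReal |g τ| + ENNReal.ofReal |g' τ|) ∂mI := by
  have hgc : Continuous g := continuous_iff_continuousAt.2 fun x => (hg x).continuousAt
  rw [lintegral_add_left (by fun_prop)]
  calc ENNReal.ofReal |g 0| = ∫⁻ _, ENNReal.ofReal |g 0| ∂mI := by simp
    _ ≤ ∫⁻ a, (ENNReal.ofReal |g a| + ∫⁻ τ, ENNReal.ofReal |g' τ| ∂mI) ∂mI := by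
        rw [mI]
        refine setLIntegral_mono' measurableSet_Ioc fun a ha => ?_
        exact line_bound g g' hg hc a ha.1.le ha.2
    _ = _ := by
        rw [lintegral_add_left (by fun_prop)]
        simp

/-- derivative along a segment at fixed time -/
lemma seg_deriv {u : Pt → ℝ} (hu : ContDiff ℝ (⊤ : ℕ∞) u) (t x y a b τ : ℝ) :
    HasDerivAt (fun τ : ℝ => u (t, x + τ * a, y + τ * b))
      (a * vd1 u (t, x + τ * a, y + τ * b) + b * vd2 u (t, x + τ * a, y + τ * b)) τ := by
  have hd : DifferentiableAt ℝ u (t, x + τ * a, y + τ * b) := (hu.differentiable (by simp)) _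
  have h1 : HasDerivAt (fun τ : ℝ => ((t, x + τ * a, y + τ * b) : Pt)) ((0:ℝ), a, b) τ := by
    refine (hasDerivAt_const _ _).prodMk (HasDerivAt.prodMk ?_ ?_)
    · simpa using ((hasDerivAt_id τ).mul_const a).const_add x
    · simpa using ((hasDerivAt_id τ).mul_const b).const_add y
  have h2 := hd.hasFDerivAt.comp_hasDerivAt τ h1
  have h3 : (((0:ℝ), a, b) : Pt) = a • ((0:ℝ), (1:ℝ), (0:ℝ)) + b • ((0:ℝ), (0:ℝ), (1:ℝ)) := by
    ext <;> simp
  rw [h3, map_add, map_smul, map_smul] at h2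
  exact h2

lemma S1_cont {u : Pt → ℝ} (hu : ContDiff ℝ (⊤ : ℕ∞) u) : Continuous (S1 u) := by
  unfold S1
  exact continuous_finsetSum _ fun α _ => (smooth_G hu α).continuous.abs

lemma S2_cont {u : Pt → ℝ} (hu : ContDiff ℝ (⊤ : ℕ∞) u) : Continuous (S2 u) := by
  unfold S2
  exact continuous_finsetSum _ fun α _ => continuous_finsetSum _ fun β _ =>
    (smooth_G (smooth_G hu α) β).continuous.abs

/-- the first order quantity with weight `R` -/
def N1 (R : ℝ) (g : Pt → ℝ) (q : Pt) : ℝ := |g q| + R * (|vd1 g q| + |vd2 g q|)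

lemma N1_cont {u : Pt → ℝ} (hu : ContDiff ℝ (⊤ : ℕ∞) u) (R : ℝ) : Continuous (N1 R u) := by
  have h0 := hu.continuous
  have h1 := (smooth_vd1 hu).continuous
  have h2 := (smooth_vd2 hu).continuous
  unfold N1
  fun_prop

lemma N1_nonneg (R : ℝ) (hR : 0 ≤ R) (g : Pt → ℝ) (q : Pt) : 0 ≤ N1 R g q := by
  unfold N1; positivity

lemma seg_abs {R : ℝ} (g : Pt → ℝ) (q : Pt) (a b : ℝ) (ha : |a| ≤ R) (hb : |b| ≤ R) :
    |a * vd1 g q + b * vd2 g q| ≤ R * (|vd1 g q| + |vd2 g q|) := by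
  refine (abs_add_le _ _).trans ?_
  rw [abs_mul, abs_mul, mul_add]
  gcongr

lemma seg_cont {g : Pt → ℝ} (hg : ContDiff ℝ (⊤ : ℕ∞) g) (t x y a b : ℝ) : Continuous (fun τ : ℝ =>
      a * vd1 g (t, x + τ * a, y + τ * b) + b * vd2 g (t, x + τ * a, y + τ * b)) := by
  have h1 := (smooth_vd1 hg).continuous
  have h2 := (smooth_vd2 hg).continuous
  fun_prop

lemma seg_avg {g : Pt → ℝ} (hg : ContDiff ℝ (⊤ : ℕ∞) g) (t x y a b R : ℝ) (ha : |a| ≤ R)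
    (hb : |b| ≤ R) :
    ENNReal.ofReal |g (t, x, y)| ≤
      ∫⁻ τ, ENNReal.ofReal (N1 R g (t, x + τ * a, y + τ * b)) ∂mI := by
  have h := line_bound_avg _ _ (fun τ => seg_deriv hg t x y a b τ) (seg_cont hg t x y a b)
  simp only [zero_mul, add_zero] at h
  refine h.trans (lintegral_mono fun τ => ?_)
  rw [← ENNReal.ofReal_add (abs_nonneg _) (abs_nonneg _)]
  apply ENNReal.ofReal_le_ofReal
  unfold N1
  gcongr
  exact seg_abs _ _ _ _ ha hb

lemma int_S1 {u : Pt → ℝ} (hu : ContDiff ℝ (⊤ : ℕ∞) u) {t : ℝ} (ht : 0 ≤ t) (x v w : ℝ × ℝ)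
    (hdet : v.1 * w.2 - w.1 * v.2 = (1 + t / 2) ^ 2 / 2)
    (hmem : ∀ a b : ℝ, 0 ≤ a → a ≤ 1 → 0 ≤ b → b ≤ 1 →
        (x.1 + (a * v.1 + b * w.1), x.2 + (a * v.2 + b * w.2)) ∈ Dsc t)
    (p : ℝ) (hp1 : 1 ≤ p)
    (τ : ℝ) (hτ : 0 < τ) (hτ1 : τ ≤ 1) (M : ℝ≥0∞)
    (hM : ∀ α, eLpNorm (fun y : ℝ × ℝ => Gfield α u (t, y)) (ENNReal.ofReal p)
      (volume.restrict (Dsc t)) ≤ M) :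
    ∫⁻ z, ENNReal.ofReal (S1 u (t, par x v w τ z)) ∂(mI.prod mI) ≤
      7 * (ENNReal.ofReal (8 * τ ^ (-(2 / p)) * (1 + t) ^ (-(2 / p))) * M) := by
  have hc : Continuous (par x v w τ) := by unfold par; fun_prop
  unfold S1
  simp_rw [ENNReal.ofReal_sum_of_nonneg (fun (i : Fin 7) (_ : i ∈ Finset.univ) => abs_nonneg _)]
  rw [lintegral_finsetSum]
  · calc _ ≤ ∑ α : Fin 7, (ENNReal.ofReal (8 * τ ^ (-(2 / p)) * (1 + t) ^ (-(2 / p))) * M) := by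
          refine Finset.sum_le_sum fun α _ => ?_
          refine (int_par_le ht x v w hdet hmem p hp1 τ hτ hτ1
            (fun y => Gfield α u (t, y)) ?_).trans ?_
          · have := (smooth_G hu α).continuous
            fun_prop
          · gcongr
            exact hM α
      _ = _ := by simp
  · intro α _
    have := (smooth_G hu α).continuous
    have h2 : Continuous fun z => |Gfield α u (t, par x v w τ z)| := by fun_prop
    exact (ENNReal.continuous_ofReal.comp h2).measurable

lemma int_S2 {u : Pt → ℝ} (hu : ContDiff ℝ (⊤ : ℕ∞) u) {t : ℝ} (ht : 0 ≤ t) (x v w : ℝ × ℝ)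
    (hdet : v.1 * w.2 - w.1 * v.2 = (1 + t / 2) ^ 2 / 2)
    (hmem : ∀ a b : ℝ, 0 ≤ a → a ≤ 1 → 0 ≤ b → b ≤ 1 →
        (x.1 + (a * v.1 + b * w.1), x.2 + (a * v.2 + b * w.2)) ∈ Dsc t)
    (p : ℝ) (hp1 : 1 ≤ p)
    (τ : ℝ) (hτ : 0 < τ) (hτ1 : τ ≤ 1) (M : ℝ≥0∞)
    (hM : ∀ α β, eLpNorm (fun y : ℝ × ℝ => Gfield β (Gfield α u) (t, y)) (ENNReal.ofReal p)
      (volume.restrict (Dsc t)) ≤ M) :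
    ∫⁻ z, ENNReal.ofReal (S2 u (t, par x v w τ z)) ∂(mI.prod mI) ≤
      49 * (ENNReal.ofReal (8 * τ ^ (-(2 / p)) * (1 + t) ^ (-(2 / p))) * M) := by
  have hc : Continuous (par x v w τ) := by unfold par; fun_prop
  have e : ∀ q, S2 u q = ∑ α : Fin 7, S1 (Gfield α u) q := fun q => rfl
  simp_rw [e, ENNReal.ofReal_sum_of_nonneg
    (fun (i : Fin 7) (_ : i ∈ Finset.univ) => S1_nonneg (Gfield i u) _)]
  rw [lintegral_finsetSum]
  · calc _ ≤ ∑ α : Fin 7, 7 * (ENNReal.ofReal (8 * τ ^ (-(2 / p)) * (1 + t) ^ (-(2 / p))) * M) := by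
          refine Finset.sum_le_sum fun α _ => ?_
          exact int_S1 (smooth_G hu α) ht x v w hdet hmem p hp1 τ hτ hτ1 M (hM α)
      _ = _ := by
        simp only [Finset.sum_const, Finset.card_univ, Fintype.card_fin, nsmul_eq_mul]
        rw [← mul_assoc]; norm_num
  · intro α _
    have := S1_cont (smooth_G hu α)
    have h2 : Continuous fun z => S1 (Gfield α u) (t, par x v w τ z) := by fun_prop
    exact (ENNReal.continuous_ofReal.comp h2).measurable

lemma second_total {u : Pt → ℝ} (hu : ContDiff ℝ (⊤ : ℕ∞) u) (q : Pt) (ht : 0 ≤ q.1)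
    (hq : q.2.1 ^ 2 + q.2.2 ^ 2 ≤ (1 + q.1 / 2) ^ 2) :
    N1 (1 + q.1 / 2) u q + (1 + q.1 / 2) * (N1 (1 + q.1 / 2) (vd1 u) q + N1 (1 + q.1 / 2) (vd2 u) q)
      ≤ 2000 * (|u q| + S1 u q + S2 u q) := by
  have f := first_bound u q ht hq
  have f1 := first_bound (vd1 u) q ht hq
  have f2 := first_bound (vd2 u) q ht hq
  have g := S1_dir hu q ht hq
  have hR : 0 ≤ 1 + q.1 / 2 := by linarith
  have s1 := S1_nonneg u q
  have s2 := S2_nonneg u q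
  have a0 := abs_nonneg (u q)
  unfold N1
  have k1 := mul_le_mul_of_nonneg_left f1.2.1 hR
  have k2 := mul_le_mul_of_nonneg_left f1.2.2 hR
  have k3 := mul_le_mul_of_nonneg_left f2.2.1 hR
  have k4 := mul_le_mul_of_nonneg_left f2.2.2 hR
  nlinarith [f.2.1, f.2.2, g.1, g.2]

/-- the `W^{2,1}` case -/
lemma case_two {u : Pt → ℝ} (hu : ContDiff ℝ (⊤ : ℕ∞) u) {t : ℝ} (ht : 0 ≤ t) (x : ℝ × ℝ)
    (hx : x ∈ Dsc t) (p : ℝ) (hp1 : 1 ≤ p) (M : ℝ≥0∞)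
    (hM0 : eLpNorm (fun y : ℝ × ℝ => u (t, y)) (ENNReal.ofReal p)
      (volume.restrict (Dsc t)) ≤ M)
    (hM1 : ∀ α, eLpNorm (fun y : ℝ × ℝ => Gfield α u (t, y)) (ENNReal.ofReal p)
      (volume.restrict (Dsc t)) ≤ M)
    (hM2 : ∀ α β, eLpNorm (fun y : ℝ × ℝ => Gfield β (Gfield α u) (t, y)) (ENNReal.ofReal p)
      (volume.restrict (Dsc t)) ≤ M) :
    ENNReal.ofReal |u (t, x)| ≤ ENNReal.ofReal (1000000 * (1 + t) ^ (-(2 / p))) * M := by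
  obtain ⟨v, w, hv1, hv2, hw1, hw2, hdet, hmem⟩ := exists_vw ht x hx
  obtain ⟨R, hR⟩ : ∃ R, R = 1 + t / 2 := ⟨_, rfl⟩
  have hR0 : 0 ≤ R := by linarith
  rw [← hR] at hv1 hv2 hw1 hw2
  have hc : Continuous (par x v w 1) := by unfold par; fun_prop
  let H : Pt → ℝ := fun q => N1 R u q + R * (N1 R (vd1 u) q + N1 R (vd2 u) q)
  have c0 := N1_cont hu R
  have c1 := N1_cont (smooth_vd1 hu) R
  have c2 := N1_cont (smooth_vd2 hu) R
  have hH : Continuous H := by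
    show Continuous fun q => N1 R u q + R * (N1 R (vd1 u) q + N1 R (vd2 u) q)
    fun_prop
  have step : ∀ a b : ℝ, ENNReal.ofReal (N1 R u (t, a, b)) ≤
      ∫⁻ σ, ENNReal.ofReal (H (t, a + σ * w.1, b + σ * w.2)) ∂mI := by
    intro a b
    have i0 := seg_avg hu t a b w.1 w.2 R hw1 hw2
    have i1 := seg_avg (smooth_vd1 hu) t a b w.1 w.2 R hw1 hw2
    have i2 := seg_avg (smooth_vd2 hu) t a b w.1 w.2 R hw1 hw2
    have n0 := fun q => N1_nonneg R hR0 u q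
    have n1 := fun q => N1_nonneg R hR0 (vd1 u) q
    have n2 := fun q => N1_nonneg R hR0 (vd2 u) q
    have e : ∀ A B C : ℝ, 0 ≤ A → 0 ≤ B → 0 ≤ C → ENNReal.ofReal (A + R * (B + C)) =
        ENNReal.ofReal A + ENNReal.ofReal R * (ENNReal.ofReal B + ENNReal.ofReal C) := by
      intro A B C hA hB hC
      rw [ENNReal.ofReal_add hA (by positivity), ENNReal.ofReal_mul hR0, ENNReal.ofReal_add hB hC]
    simp only [H, e _ _ _ (n0 _) (n1 _) (n2 _)]
    rw [N1, e _ _ _ (abs_nonneg _) (abs_nonneg _) (abs_nonneg _)]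
    rw [lintegral_add_left (by fun_prop), lintegral_const_mul _ (by fun_prop),
      lintegral_add_left (by fun_prop)]
    gcongr
  have h1 : ENNReal.ofReal |u (t, x)| ≤
      ∫⁻ z, ENNReal.ofReal (H (t, par x v w 1 z)) ∂(mI.prod mI) := by
    rw [lintegral_prod _ (by fun_prop)]
    refine (seg_avg hu t x.1 x.2 v.1 v.2 R hv1 hv2).trans (lintegral_mono fun a => ?_)
    refine (step _ _).trans (lintegral_mono fun b => ?_)
    apply le_of_eq
    congr 3
    ext <;> simp only [par] <;> ring
  have hae : ∀ᵐ z ∂(mI.prod mI), par x v w 1 z ∈ Dsc t := by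
    rw [mI, Measure.prod_restrict]
    refine ae_restrict_of_forall_mem (measurableSet_Ioc.prod measurableSet_Ioc) ?_
    rintro ⟨a, b⟩ ⟨ha, hb⟩
    have := hmem a b ha.1.le ha.2 hb.1.le hb.2
    simpa [par] using this
  have h2 : ∫⁻ z, ENNReal.ofReal (H (t, par x v w 1 z)) ∂(mI.prod mI) ≤
      ∫⁻ z, ENNReal.ofReal 2000 * (ENNReal.ofReal |u (t, par x v w 1 z)| +
        ENNReal.ofReal (S1 u (t, par x v w 1 z)) + ENNReal.ofReal (S2 u (t, par x v w 1 z)))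
        ∂(mI.prod mI) := by
    refine lintegral_mono_ae ?_
    filter_upwards [hae] with z hz
    have s1 := S1_nonneg u (t, par x v w 1 z)
    have s2 := S2_nonneg u (t, par x v w 1 z)
    rw [← ENNReal.ofReal_add (abs_nonneg _) s1, ← ENNReal.ofReal_add (by positivity) s2,
      ← ENNReal.ofReal_mul (by norm_num)]
    apply ENNReal.ofReal_le_ofReal
    simp only [H]
    rw [hR]
    exact second_total hu (t, par x v w 1 z) ht ((mem_Dsc ht _).1 hz)
  refine h1.trans (h2.trans ?_)
  have k0 := hu.continuous
  have k1 := S1_cont hu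
  have k2 := S2_cont hu
  rw [lintegral_const_mul _ (by fun_prop), lintegral_add_left (by fun_prop),
    lintegral_add_left (by fun_prop)]
  have j0 := int_par_le ht x v w hdet hmem p hp1 1 one_pos le_rfl (fun y => u (t, y)) (by fun_prop)
  have j1 := int_S1 hu ht x v w hdet hmem p hp1 1 one_pos le_rfl M hM1
  have j2 := int_S2 hu ht x v w hdet hmem p hp1 1 one_pos le_rfl M hM2
  rw [Real.one_rpow, mul_one] at j0 j1 j2
  have hT : 0 ≤ (1 + t) ^ (-(2 / p)) := by positivity
  calc _ ≤ ENNReal.ofReal 2000 * (ENNReal.ofReal (8 * (1 + t) ^ (-(2 / p))) * M +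
        7 * (ENNReal.ofReal (8 * (1 + t) ^ (-(2 / p))) * M) +
        49 * (ENNReal.ofReal (8 * (1 + t) ^ (-(2 / p))) * M)) := by
        gcongr
        exact j0.trans (by gcongr)
    _ = ENNReal.ofReal (2000 * 57 * (8 * (1 + t) ^ (-(2 / p)))) * M := by
        rw [ENNReal.ofReal_mul (p := 2000 * 57) (by norm_num), ENNReal.ofReal_mul (p := 2000) (by norm_num)]
        rw [show ENNReal.ofReal 57 = 57 by simp]
        ring
    _ ≤ _ := by
        gcongr ENNReal.ofReal ?_ * M
        linarith

/-- the Morrey case -/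
lemma case_one {u : Pt → ℝ} (hu : ContDiff ℝ (⊤ : ℕ∞) u) {t : ℝ} (ht : 0 ≤ t) (x : ℝ × ℝ)
    (hx : x ∈ Dsc t) (p : ℝ) (hp1 : 1 ≤ p) (M : ℝ≥0∞)
    (hM0 : eLpNorm (fun y : ℝ × ℝ => u (t, y)) (ENNReal.ofReal p)
      (volume.restrict (Dsc t)) ≤ M)
    (hM1 : ∀ α, eLpNorm (fun y : ℝ × ℝ => Gfield α u (t, y)) (ENNReal.ofReal p)
      (volume.restrict (Dsc t)) ≤ M) :
    ENNReal.ofReal |u (t, x)| ≤ (8 + 672 * ∫⁻ τ, ENNReal.ofReal (τ ^ (-(2 / p))) ∂mI) *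
      ENNReal.ofReal ((1 + t) ^ (-(2 / p))) * M := by
  obtain ⟨v, w, hv1, hv2, hw1, hw2, hdet, hmem⟩ := exists_vw ht x hx
  have hc := par_cont x v w
  have hc1 : Continuous (par x v w 1) := by unfold par; fun_prop
  have k0 := hu.continuous
  have k1 := S1_cont hu
  have hT : 0 ≤ (1 + t) ^ (-(2 / p)) := by positivity
  have pt : ∀ z : ℝ × ℝ, z ∈ Set.Ioc (0:ℝ) 1 ×ˢ Set.Ioc (0:ℝ) 1 → ENNReal.ofReal |u (t, x)| ≤
      ENNReal.ofReal |u (t, par x v w 1 z)| +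
      ∫⁻ τ, 12 * ENNReal.ofReal (S1 u (t, par x v w τ z)) ∂mI := by
    rintro ⟨a, b⟩ ⟨ha, hb⟩
    have ha' : 0 < a ∧ a ≤ 1 := ha
    have hb' : 0 < b ∧ b ≤ 1 := hb
    have hR0 : 0 ≤ 1 + t / 2 := by linarith
    have bd : ∀ m n : ℝ, |m| ≤ 1 + t / 2 → |n| ≤ 1 + t / 2 → |a * m + b * n| ≤ 2 * (1 + t / 2) := by
      intro m n hm hn
      refine (abs_add_le _ _).trans ?_
      rw [abs_mul, abs_mul, abs_of_pos ha'.1, abs_of_pos hb'.1]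
      nlinarith [mul_le_of_le_one_left (abs_nonneg m) ha'.2, mul_le_of_le_one_left (abs_nonneg n) hb'.2]
    have h := line_bound _ _ (fun τ => seg_deriv hu t x.1 x.2 (a * v.1 + b * w.1) (a * v.2 + b * w.2) τ)
      (seg_cont hu t x.1 x.2 (a * v.1 + b * w.1) (a * v.2 + b * w.2)) 1 zero_le_one le_rfl
    simp only [zero_mul, add_zero] at h
    refine h.trans (add_le_add le_rfl ?_)
    rw [mI]
    refine setLIntegral_mono' measurableSet_Ioc fun τ hτ => ?_
    have hD : par x v w τ (a, b) ∈ Dsc t := by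
      have := hmem (τ * a) (τ * b) (mul_nonneg hτ.1.le ha'.1.le) (mul_le_one₀ hτ.2 ha'.1.le ha'.2)
        (mul_nonneg hτ.1.le hb'.1.le) (mul_le_one₀ hτ.2 hb'.1.le hb'.2)
      have e : par x v w τ (a, b) = (x.1 + (τ * a * v.1 + τ * b * w.1), x.2 + (τ * a * v.2 + τ * b * w.2)) := by
        ext <;> simp only [par] <;> ring
      rw [e]; exact this
    have f := first_bound u (t, par x v w τ (a, b)) ht ((mem_Dsc ht _).1 hD)
    have g := seg_abs u (t, par x v w τ (a, b)) _ _ (bd _ _ hv1 hw1) (bd _ _ hv2 hw2)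
    rw [show (12 : ℝ≥0∞) = ENNReal.ofReal 12 by simp, ← ENNReal.ofReal_mul (by norm_num)]
    apply ENNReal.ofReal_le_ofReal
    refine le_trans g ?_
    have f1 := f.2.1
    have f2 := f.2.2
    simp only at f1 f2
    linarith
  have j0 := int_par_le ht x v w hdet hmem p hp1 1 one_pos le_rfl (fun y => u (t, y)) (by fun_prop)
  rw [Real.one_rpow, mul_one] at j0
  calc ENNReal.ofReal |u (t, x)| = ∫⁻ _, ENNReal.ofReal |u (t, x)| ∂(mI.prod mI) := by simp
    _ ≤ ∫⁻ z, (ENNReal.ofReal |u (t, par x v w 1 z)| +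
      ∫⁻ τ, 12 * ENNReal.ofReal (S1 u (t, par x v w τ z)) ∂mI) ∂(mI.prod mI) := by
        refine lintegral_mono_ae ?_
        have : ∀ᵐ z ∂(mI.prod mI), z ∈ Set.Ioc (0:ℝ) 1 ×ˢ Set.Ioc (0:ℝ) 1 := by
          rw [mI, Measure.prod_restrict]
          exact ae_restrict_mem (measurableSet_Ioc.prod measurableSet_Ioc)
        filter_upwards [this] with z hz using pt z hz
    _ = ∫⁻ z, ENNReal.ofReal |u (t, par x v w 1 z)| ∂(mI.prod mI) +
        ∫⁻ τ, ∫⁻ z, 12 * ENNReal.ofReal (S1 u (t, par x v w τ z)) ∂(mI.prod mI) ∂mI := by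
        rw [lintegral_add_left (by fun_prop), lintegral_lintegral_swap]
        apply Measurable.aemeasurable
        have : Continuous fun q : (ℝ × ℝ) × ℝ => S1 u (t, par x v w q.2 q.1) :=
          k1.comp (continuous_const.prodMk (hc.comp (continuous_snd.prodMk continuous_fst)))
        exact (ENNReal.continuous_ofReal.comp this).measurable.const_mul 12
    _ ≤ ENNReal.ofReal (8 * (1 + t) ^ (-(2 / p))) * M +
        ∫⁻ τ, ENNReal.ofReal (τ ^ (-(2 / p))) *
          (672 * (ENNReal.ofReal ((1 + t) ^ (-(2 / p))) * M)) ∂mI := by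
        refine add_le_add (j0.trans (by gcongr)) ?_
        rw [mI]
        refine setLIntegral_mono' measurableSet_Ioc fun τ hτ => ?_
        have hk : Continuous fun z => S1 u (t, par x v w τ z) :=
          k1.comp (continuous_const.prodMk (hc.comp (continuous_const.prodMk continuous_id)))
        have hk' : Measurable fun z => ENNReal.ofReal (S1 u (t, par x v w τ z)) :=
          (ENNReal.continuous_ofReal.comp hk).measurable
        have hτ0 : 0 ≤ τ ^ (-(2 / p)) := Real.rpow_nonneg hτ.1.le _
        change ∫⁻ z, 12 * ENNReal.ofReal (S1 u (t, par x v w τ z)) ∂(mI.prod mI) ≤ _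
        rw [lintegral_const_mul _ hk']
        refine (mul_le_mul_right (int_S1 hu ht x v w hdet hmem p hp1 τ hτ.1 hτ.2 M hM1) 12).trans ?_
        rw [ENNReal.ofReal_mul (by positivity), ENNReal.ofReal_mul (by positivity)]
        rw [show ENNReal.ofReal 8 = 8 by simp]
        apply le_of_eq
        ring
    _ = _ := by
        rw [lintegral_mul_const _ (by fun_prop), ENNReal.ofReal_mul (by norm_num)]
        rw [show ENNReal.ofReal 8 = 8 by simp]
        ring

lemma const_fin (p : ℝ) (hp : 2 < p) : ∫⁻ τ, ENNReal.ofReal (τ ^ (-(2 / p))) ∂mI ≠ ⊤ := by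
  have h : -1 < -(2 / p) := by
    have : 2 / p < 1 := by rw [div_lt_one (by linarith)]; exact hp
    linarith
  have := (intervalIntegral.intervalIntegrable_rpow' (a := 0) (b := 1) h)
  rw [intervalIntegrable_iff_integrableOn_Ioc_of_le zero_le_one] at this
  exact this.lintegral_lt_top.ne

/-- Decaying Sobolev inequality inside the light cone: for `s ≥ 1`, `1 ≤ p < ∞` with `sp > 2`
there is `C > 0` such that for every smooth `u`, `t ≥ 0` and `|x| ≤ 1 + t/2`,
`|u(t,x)| ≤ C (1+t)^{−2/p} Σ_{|k| ≤ s} ‖Γ^k u(t,·)‖_{L^p({|x| ≤ 1 + t/2})}`. -/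
theorem stmt_13 (s : ℕ) (hs : 1 ≤ s) (p : ℝ) (hp1 : 1 ≤ p) (hsp : 2 < (s : ℝ) * p) :
    ∃ C > (0:ℝ), ∀ u : Pt → ℝ, ContDiff ℝ (⊤ : ℕ∞) u → ∀ t : ℝ, 0 ≤ t →
      ∀ x : ℝ × ℝ, Real.sqrt (x.1 ^ 2 + x.2 ^ 2) ≤ 1 + t / 2 →
        ENNReal.ofReal |u (t, x)| ≤
          ENNReal.ofReal (C * (1 + t) ^ (-(2 / p))) *
            ∑ k ∈ Finset.range (s + 1), ∑ ks : Fin k → Fin 7,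
              eLpNorm (fun y : ℝ × ℝ => GComp (List.ofFn ks) u (t, y)) (ENNReal.ofReal p)
                (volume.restrict {y : ℝ × ℝ | Real.sqrt (y.1 ^ 2 + y.2 ^ 2) ≤ 1 + t / 2}) := by
  have key : ∀ (u : Pt → ℝ) (t : ℝ) (l : List (Fin 7)), l.length ≤ s →
      eLpNorm (fun y : ℝ × ℝ => GComp l u (t, y)) (ENNReal.ofReal p) (volume.restrict (Dsc t)) ≤
      ∑ k ∈ Finset.range (s + 1), ∑ ks : Fin k → Fin 7,
              eLpNorm (fun y : ℝ × ℝ => GComp (List.ofFn ks) u (t, y)) (ENNReal.ofReal p)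
                (volume.restrict {y : ℝ × ℝ | Real.sqrt (y.1 ^ 2 + y.2 ^ 2) ≤ 1 + t / 2}) := by
    intro u t l hl
    have h1 := Finset.single_le_sum (s := Finset.range (s + 1))
      (f := fun k => ∑ ks : Fin k → Fin 7,
              eLpNorm (fun y : ℝ × ℝ => GComp (List.ofFn ks) u (t, y)) (ENNReal.ofReal p)
                (volume.restrict {y : ℝ × ℝ | Real.sqrt (y.1 ^ 2 + y.2 ^ 2) ≤ 1 + t / 2}))
      (fun _ _ => zero_le) (Finset.mem_range.2 (Nat.lt_succ_of_le hl))
    refine le_trans ?_ h1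
    have h2 := Finset.single_le_sum (s := (Finset.univ : Finset (Fin l.length → Fin 7)))
      (f := fun ks =>
              eLpNorm (fun y : ℝ × ℝ => GComp (List.ofFn ks) u (t, y)) (ENNReal.ofReal p)
                (volume.restrict {y : ℝ × ℝ | Real.sqrt (y.1 ^ 2 + y.2 ^ 2) ≤ 1 + t / 2}))
      (fun _ _ => zero_le) (Finset.mem_univ l.get)
    refine le_trans ?_ h2
    simp only [List.ofFn_get]
    exact le_rfl
  rcases hs.eq_or_lt with h | h
  · have hp : 2 < p := by rw [← h] at hsp; simpa using hsp
    have hfin := const_fin p hp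
    have hK : (8 + 672 * ∫⁻ τ, ENNReal.ofReal (τ ^ (-(2 / p))) ∂mI) ≠ ⊤ := by finiteness
    refine ⟨(8 + 672 * ∫⁻ τ, ENNReal.ofReal (τ ^ (-(2 / p))) ∂mI).toReal,
      ENNReal.toReal_pos (by simp) hK, ?_⟩
    intro u hu t ht x hx
    rw [ENNReal.ofReal_mul ENNReal.toReal_nonneg, ENNReal.ofReal_toReal hK]
    exact case_one hu ht x hx p hp1 _ (key u t [] (by simp)) (fun α => key u t [α] (by simpa using hs))
  · refine ⟨1000000, by norm_num, ?_⟩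
    intro u hu t ht x hx
    exact case_two hu ht x hx p hp1 _ (key u t [] (by simp))
      (fun α => key u t [α] (by simpa using hs)) (fun α β => key u t [β, α] (by simpa using Nat.succ_le_of_lt h))
end
end

section
/- Let F : ℝ → ℝ be a smooth function with F(0) = 0, let s ≥ 0 be an integer and 1 ≤ p ≤ ∞. There exists a constant C > 0 (depending on F, s, p) such that for every smooth function w : ℝ × ℝ² → ℝ and every t for which ‖w(t,·)‖_{Γ,⌊s/2⌋,L^∞} ≤ 1, one has ‖(F∘w)(t,·)‖_{Γ,s,L^p} ≤ C ‖w(t,·)‖_{Γ,s,L^p}. -/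
open MeasureTheory ENNReal

noncomputable section

/-- The vector whose directional derivative is the field. -/
def gV (i : Fin 7) (p : Pt) : Pt :=
  (![((1:ℝ), (0:ℝ), (0:ℝ)), (0, 1, 0), (0, 0, 1), (0, -p.2.2, p.2.1), (p.1, p.2.1, p.2.2),
    (p.2.1, p.1, 0), (p.2.2, 0, p.1)] : Fin 7 → Pt) i

lemma clm_split (L : Pt →L[ℝ] ℝ) (a b c : ℝ) :
    L (a, b, c) = a * L (1, 0, 0) + b * L (0, 1, 0) + c * L (0, 0, 1) := by
  have h : ((a, b, c) : Pt) = a • ((1:ℝ), (0:ℝ), (0:ℝ)) + b • ((0:ℝ), (1:ℝ), (0:ℝ))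
      + c • ((0:ℝ), (0:ℝ), (1:ℝ)) := by simp
  rw [h, map_add, map_add, map_smul, map_smul, map_smul]
  simp

lemma Gfield_eq (i : Fin 7) (u : Pt → ℝ) (p : Pt) :
    Gfield i u p = fderiv ℝ u p (gV i p) := by
  fin_cases i <;> simp [Gfield, gV, vdt, vd1, vd2, vOm, vL0, vL1, vL2]
  · rw [clm_split _ 0 (-p.2.2)]; ring
  · rw [clm_split _ p.1]
  · rw [clm_split _ p.2.1]; ring
  · rw [clm_split _ p.2.2]; ring

lemma gV_contDiff (i : Fin 7) : ContDiff ℝ (⊤ : ℕ∞) (gV i) := by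
  unfold gV
  fin_cases i <;> simp <;> fun_prop

lemma Gfield_contDiff (i : Fin 7) {u : Pt → ℝ} (hu : ContDiff ℝ (⊤ : ℕ∞) u) :
    ContDiff ℝ (⊤ : ℕ∞) (Gfield i u) := by
  have : Gfield i u = fun p => fderiv ℝ u p (gV i p) := funext (Gfield_eq i u)
  rw [this]
  exact (hu.fderiv_right (m := (⊤ : ℕ∞)) (by simp)).clm_apply (gV_contDiff i)

lemma GComp_contDiff (l : List (Fin 7)) {u : Pt → ℝ} (hu : ContDiff ℝ (⊤ : ℕ∞) u) :
    ContDiff ℝ (⊤ : ℕ∞) (GComp l u) := by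
  induction l with
  | nil => exact hu
  | cons i l ih => exact Gfield_contDiff i ih

lemma Gfield_mul (i : Fin 7) {u v : Pt → ℝ} (hu : ContDiff ℝ (⊤ : ℕ∞) u)
    (hv : ContDiff ℝ (⊤ : ℕ∞) v) :
    Gfield i (fun q => u q * v q) = fun q => Gfield i u q * v q + u q * Gfield i v q := by
  funext q
  have h1 : DifferentiableAt ℝ u q := hu.differentiable (by simp) q
  have h2 : DifferentiableAt ℝ v q := hv.differentiable (by simp) q
  simp only [Gfield_eq]
  rw [fderiv_fun_mul h1 h2]
  simp
  ring

lemma Gfield_add (i : Fin 7) {u v : Pt → ℝ} (hu : ContDiff ℝ (⊤ : ℕ∞) u)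
    (hv : ContDiff ℝ (⊤ : ℕ∞) v) :
    Gfield i (fun q => u q + v q) = fun q => Gfield i u q + Gfield i v q := by
  funext q
  have h1 : DifferentiableAt ℝ u q := hu.differentiable (by simp) q
  have h2 : DifferentiableAt ℝ v q := hv.differentiable (by simp) q
  simp only [Gfield_eq]
  rw [fderiv_fun_add h1 h2]
  simp

lemma Gfield_comp (i : Fin 7) {f : ℝ → ℝ} (hf : ContDiff ℝ (⊤ : ℕ∞) f) {u : Pt → ℝ}
    (hu : ContDiff ℝ (⊤ : ℕ∞) u) :
    Gfield i (fun q => f (u q)) = fun q => deriv f (u q) * Gfield i u q := by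
  funext q
  have h1 : DifferentiableAt ℝ u q := hu.differentiable (by simp) q
  have h2 : DifferentiableAt ℝ f (u q) := hf.differentiable (by simp) _
  simp only [Gfield_eq]
  have := (h2.hasDerivAt.comp_hasFDerivAt q h1.hasFDerivAt).fderiv
  have e : (fun q => f (u q)) = f ∘ u := rfl
  rw [e, this]
  simp

/-- Operators that are sums of products `f(w) Γ^{l₁}w ⋯ Γ^{l_j}w` of total order `n`, `j ≥ 1`. -/
inductive GoodOp : ℕ → ((Pt → ℝ) → Pt → ℝ) → Prop
  | comp (f : ℝ → ℝ) (hf : ContDiff ℝ (⊤ : ℕ∞) f) (l : List (Fin 7)) :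
      GoodOp l.length (fun w q => f (w q) * GComp l w q)
  | mul (n : ℕ) (T : (Pt → ℝ) → Pt → ℝ) (l : List (Fin 7)) (h : GoodOp n T) :
      GoodOp (n + l.length) (fun w q => T w q * GComp l w q)
  | add (n : ℕ) (T T' : (Pt → ℝ) → Pt → ℝ) (h : GoodOp n T) (h' : GoodOp n T') :
      GoodOp n (fun w q => T w q + T' w q)

lemma GoodOp.contDiff {n : ℕ} {T : (Pt → ℝ) → Pt → ℝ} (h : GoodOp n T) {w : Pt → ℝ}
    (hw : ContDiff ℝ (⊤ : ℕ∞) w) : ContDiff ℝ (⊤ : ℕ∞) (T w) := by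
  induction h with
  | comp f hf l => exact (hf.comp hw).mul (GComp_contDiff l hw)
  | mul n T l h ih => exact ih.mul (GComp_contDiff l hw)
  | add n T T' h h' ih ih' => exact ih.add ih'

lemma GoodOp.gfield {n : ℕ} {T : (Pt → ℝ) → Pt → ℝ} (h : GoodOp n T) (i : Fin 7) :
    ∃ T', GoodOp (n + 1) T' ∧ ∀ w, ContDiff ℝ (⊤ : ℕ∞) w → Gfield i (T w) = T' w := by
  induction h with
  | comp f hf l =>
    have hf' : ContDiff ℝ (⊤ : ℕ∞) (deriv f) := (contDiff_infty_iff_deriv.1 hf).2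
    refine ⟨_, GoodOp.add _ _ _ (GoodOp.mul _ _ [i] (GoodOp.comp (deriv f) hf' l))
      (GoodOp.comp f hf (i :: l)), ?_⟩
    intro w hw
    refine (Gfield_mul i (hf.comp hw) (GComp_contDiff l hw)).trans ?_
    have := Gfield_comp i hf hw
    funext q
    have := congrFun this q
    simp only [Function.comp_def, GComp, List.foldr] at this ⊢
    rw [this]; ring
  | mul n T l h ih =>
    obtain ⟨T', hT', e⟩ := ih
    have h1 := GoodOp.mul _ _ l hT'
    rw [show n + 1 + l.length = n + l.length + 1 by omega] at h1
    refine ⟨_, GoodOp.add _ _ _ h1 (GoodOp.mul _ _ (i :: l) h), ?_⟩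
    intro w hw
    rw [Gfield_mul i (h.contDiff hw) (GComp_contDiff l hw), e w hw]
    rfl
  | add n T T' h h' ih ih' =>
    obtain ⟨S, hS, e⟩ := ih
    obtain ⟨S', hS', e'⟩ := ih'
    refine ⟨_, GoodOp.add _ _ _ hS hS', ?_⟩
    intro w hw
    rw [Gfield_add i (h.contDiff hw) (h'.contDiff hw), e w hw, e' w hw]

lemma exists_goodOp {F : ℝ → ℝ} (hF : ContDiff ℝ (⊤ : ℕ∞) F) (i : Fin 7) (l : List (Fin 7)) :
    ∃ T, GoodOp (l.length + 1) T ∧ ∀ w, ContDiff ℝ (⊤ : ℕ∞) w →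
      GComp (i :: l) (fun q => F (w q)) = T w := by
  induction l generalizing i with
  | nil =>
    have hf' : ContDiff ℝ (⊤ : ℕ∞) (deriv F) := (contDiff_infty_iff_deriv.1 hF).2
    exact ⟨_, GoodOp.comp _ hf' [i], fun w hw => Gfield_comp i hF hw⟩
  | cons j l ih =>
    obtain ⟨T, hT, e⟩ := ih j
    obtain ⟨T', hT', e'⟩ := hT.gfield i
    refine ⟨T', hT', fun w hw => ?_⟩
    rw [← e' w hw, ← e w hw]
    rfl

/-- Pointwise sum of all derivatives up to order `s`. -/
def gSum (s : ℕ) (w : Pt → ℝ) (q : Pt) : ℝ :=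
  ∑ k ∈ Finset.range (s + 1), ∑ ks : Fin k → Fin 7, ‖GComp (List.ofFn ks) w q‖

lemma le_gSum {s : ℕ} (w : Pt → ℝ) (q : Pt) {l : List (Fin 7)} (hl : l.length ≤ s) :
    |GComp l w q| ≤ gSum s w q := by
  have h1 : |GComp l w q| ≤ ∑ ks : Fin l.length → Fin 7, ‖GComp (List.ofFn ks) w q‖ := by
    have := Finset.single_le_sum (f := fun ks : Fin l.length → Fin 7 =>
      ‖GComp (List.ofFn ks) w q‖) (fun _ _ => norm_nonneg _) (Finset.mem_univ l.get)
    simpa using this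
  refine h1.trans ?_
  exact Finset.single_le_sum (f := fun k => ∑ ks : Fin k → Fin 7, ‖GComp (List.ofFn ks) w q‖)
    (fun _ _ => Finset.sum_nonneg fun _ _ => norm_nonneg _) (Finset.mem_range.2 (by omega))

lemma cont_bound {f : ℝ → ℝ} (hf : Continuous f) : ∃ C, 0 ≤ C ∧ ∀ x, |x| ≤ 1 → |f x| ≤ C := by
  obtain ⟨C, hC⟩ := (isCompact_Icc (a := (-1:ℝ)) (b := 1)).exists_bound_of_continuousOn
    hf.continuousOn
  have h : ∀ x, |x| ≤ 1 → |f x| ≤ C := fun x hx => hC x (abs_le.1 hx)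
  exact ⟨C, (abs_nonneg _).trans (h 0 (by simp)), h⟩

lemma GoodOp.bound {n : ℕ} {T : (Pt → ℝ) → Pt → ℝ} (h : GoodOp n T) (s : ℕ) (hn : n ≤ s) :
    ∃ C, 0 ≤ C ∧ ∀ w q, (∀ l : List (Fin 7), l.length ≤ s / 2 → |GComp l w q| ≤ 1) →
      |T w q| ≤ C * gSum s w q ∧ (n ≤ s / 2 → |T w q| ≤ C) := by
  induction h with
  | comp f hf l =>
    obtain ⟨C, hC0, hC⟩ := cont_bound hf.continuous
    refine ⟨C, hC0, fun w q hw => ?_⟩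
    have h1 : |f (w q)| ≤ C := hC _ (hw [] (by simp))
    rw [abs_mul]
    refine ⟨mul_le_mul h1 (le_gSum w q hn) (abs_nonneg _) hC0, fun hl => ?_⟩
    simpa using mul_le_mul h1 (hw l hl) (abs_nonneg _) hC0
  | mul n T l h ih =>
    obtain ⟨C, hC0, hC⟩ := ih (by omega)
    refine ⟨C, hC0, fun w q hw => ?_⟩
    obtain ⟨h1, h2⟩ := hC w q hw
    rw [abs_mul]
    constructor
    · by_cases hl : l.length ≤ s / 2
      · exact (mul_le_of_le_one_right (abs_nonneg _) (hw l hl)).trans h1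
      · exact mul_le_mul (h2 (by omega)) (le_gSum w q (by omega)) (abs_nonneg _) hC0
    · intro hl
      exact (mul_le_of_le_one_right (abs_nonneg _) (hw l (by omega))).trans (h2 (by omega))
  | add n T T' h h' ih ih' =>
    obtain ⟨C, hC0, hC⟩ := ih hn
    obtain ⟨C', hC0', hC'⟩ := ih' hn
    refine ⟨C + C', by positivity, fun w q hw => ?_⟩
    obtain ⟨h1, h2⟩ := hC w q hw
    obtain ⟨h1', h2'⟩ := hC' w q hw
    have h3 := abs_add_le (T w q) (T' w q)
    refine ⟨by linarith, fun hl => ?_⟩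
    have := h2 hl
    have := h2' hl
    linarith

lemma pointwise_bound {F : ℝ → ℝ} (hF : ContDiff ℝ (⊤ : ℕ∞) F) (hF0 : F 0 = 0) (s : ℕ)
    (l : List (Fin 7)) (hl : l.length ≤ s) :
    ∃ C, 0 ≤ C ∧ ∀ w, ContDiff ℝ (⊤ : ℕ∞) w → ∀ q,
      (∀ l : List (Fin 7), l.length ≤ s / 2 → |GComp l w q| ≤ 1) →
      |GComp l (fun q => F (w q)) q| ≤ C * gSum s w q := by
  cases l with
  | nil =>
    have hf' : ContDiff ℝ (⊤ : ℕ∞) (deriv F) := (contDiff_infty_iff_deriv.1 hF).2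
    obtain ⟨C, hC0, hC⟩ := cont_bound hf'.continuous
    refine ⟨C, hC0, fun w hw q h => ?_⟩
    have h0 : |w q| ≤ 1 := h [] (by simp)
    have h1 : |w q| ≤ gSum s w q := le_gSum w q (l := []) (by simp)
    have h2 := (convex_Icc (-1:ℝ) 1).norm_image_sub_le_of_norm_deriv_le (f := F) (C := C)
      (fun x _ => hF.differentiable (by simp) x) (fun x hx => hC x (abs_le.2 (Set.mem_Icc.1 hx)))
      (x := 0) (y := w q) (Set.mem_Icc.2 ⟨by norm_num, by norm_num⟩)
      (Set.mem_Icc.2 (abs_le.1 h0))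
    rw [hF0, sub_zero, sub_zero] at h2
    exact le_trans h2 (mul_le_mul_of_nonneg_left h1 hC0)
  | cons i l =>
    obtain ⟨T, hT, e⟩ := exists_goodOp hF i l
    obtain ⟨C, hC0, hC⟩ := hT.bound s hl
    refine ⟨C, hC0, fun w hw q h => ?_⟩
    rw [e w hw]
    exact (hC w q h).1

lemma slice_meas {w : Pt → ℝ} (hw : ContDiff ℝ (⊤ : ℕ∞) w) (l : List (Fin 7)) (t : ℝ) :
    Continuous (fun x : ℝ × ℝ => GComp l w (t, x)) :=
  (GComp_contDiff l hw).continuous.comp (by fun_prop)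

lemma eLpNorm_gSum_le {w : Pt → ℝ} (hw : ContDiff ℝ (⊤ : ℕ∞) w) (s : ℕ) (p : ℝ≥0∞)
    (hp : 1 ≤ p) (t : ℝ) :
    eLpNorm (fun x : ℝ × ℝ => gSum s w (t, x)) p volume ≤ GammaNorm s p w t := by
  have e : (fun x : ℝ × ℝ => gSum s w (t, x)) = ∑ k ∈ Finset.range (s + 1),
      ∑ ks : Fin k → Fin 7, fun x : ℝ × ℝ => ‖GComp (List.ofFn ks) w (t, x)‖ := by
    funext x
    simp [gSum, Finset.sum_apply]
  have hc : ∀ k, ∀ ks : Fin k → Fin 7,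
      Continuous (fun x : ℝ × ℝ => ‖GComp (List.ofFn ks) w (t, x)‖) :=
    fun k ks => (slice_meas hw _ t).norm
  rw [e]
  refine (eLpNorm_sum_le (fun k _ => ?_) hp).trans (Finset.sum_le_sum fun k _ => ?_)
  · exact Finset.aestronglyMeasurable_sum _ fun ks _ => (hc k ks).aestronglyMeasurable
  · refine (eLpNorm_sum_le (fun ks _ => (hc k ks).aestronglyMeasurable) hp).trans
      (Finset.sum_le_sum fun ks _ => ?_)
    rw [eLpNorm_norm]

lemma le_GammaNorm {m : ℕ} (p : ℝ≥0∞) (w : Pt → ℝ) (t : ℝ) {l : List (Fin 7)}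
    (hl : l.length ≤ m) :
    eLpNorm (fun x : ℝ × ℝ => GComp l w (t, x)) p volume ≤ GammaNorm m p w t := by
  have h1 := Finset.single_le_sum (f := fun ks : Fin l.length → Fin 7 =>
      eLpNorm (fun x : ℝ × ℝ => GComp (List.ofFn ks) w (t, x)) p volume)
      (fun _ _ => zero_le) (Finset.mem_univ l.get)
  have h2 := Finset.single_le_sum (f := fun k => ∑ ks : Fin k → Fin 7,
      eLpNorm (fun x : ℝ × ℝ => GComp (List.ofFn ks) w (t, x)) p volume)
      (fun _ _ => zero_le) (Finset.mem_range.2 (show l.length < m + 1 by omega))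
  refine le_trans ?_ h2
  simpa using h1

lemma ae_small {m : ℕ} {w : Pt → ℝ} {t : ℝ} (h : GammaNorm m ⊤ w t ≤ 1) :
    ∀ᵐ x : ℝ × ℝ, ∀ l : List (Fin 7), l.length ≤ m → |GComp l w (t, x)| ≤ 1 := by
  rw [ae_all_iff]
  intro l
  by_cases hl : l.length ≤ m
  · have h1 := (le_GammaNorm ⊤ w t hl).trans h
    rw [eLpNorm_exponent_top] at h1
    filter_upwards [ae_le_eLpNormEssSup (f := fun x : ℝ × ℝ => GComp l w (t, x)) (μ := volume)]
      with x hx _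
    have h2 := hx.trans h1
    have h3 : ‖GComp l w (t, x)‖₊ ≤ 1 := by
      rw [enorm_eq_nnnorm] at h2
      exact_mod_cast h2
    exact_mod_cast h3
  · exact Filter.Eventually.of_forall fun x h => absurd h hl

/-- Moser-type estimate for composite functions: if `F` is smooth with `F(0) = 0`, `s ≥ 0`
and `1 ≤ p ≤ ∞`, then there is `C > 0` such that for all smooth `w` and all times `t` with
`‖w(t,·)‖_{Γ,⌊s/2⌋,L^∞} ≤ 1`, one has `‖F∘w(t,·)‖_{Γ,s,L^p} ≤ C‖w(t,·)‖_{Γ,s,L^p}`. -/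
theorem stmt_14 (F : ℝ → ℝ) (hF : ContDiff ℝ (⊤ : ℕ∞) F) (hF0 : F 0 = 0)
    (s : ℕ) (p : ℝ≥0∞) (hp : 1 ≤ p) :
    ∃ C > (0:ℝ), ∀ w : Pt → ℝ, ContDiff ℝ (⊤ : ℕ∞) w → ∀ t : ℝ,
      GammaNorm (s / 2) ⊤ w t ≤ 1 →
      GammaNorm s p (fun q => F (w q)) t ≤ ENNReal.ofReal C * GammaNorm s p w t := by
  have key : ∀ l : List (Fin 7), ∃ C, 0 ≤ C ∧ (l.length ≤ s → ∀ w, ContDiff ℝ (⊤ : ℕ∞) w → ∀ q,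
      (∀ l : List (Fin 7), l.length ≤ s / 2 → |GComp l w q| ≤ 1) →
      |GComp l (fun q => F (w q)) q| ≤ C * gSum s w q) := by
    intro l
    by_cases hl : l.length ≤ s
    · obtain ⟨C, hC0, hC⟩ := pointwise_bound hF hF0 s l hl
      exact ⟨C, hC0, fun _ => hC⟩
    · exact ⟨0, le_rfl, fun h => absurd h hl⟩
  choose C hC0 hC using key
  refine ⟨(∑ k ∈ Finset.range (s + 1), ∑ ks : Fin k → Fin 7, C (List.ofFn ks)) + 1, ?_, ?_⟩
  · have : 0 ≤ ∑ k ∈ Finset.range (s + 1), ∑ ks : Fin k → Fin 7, C (List.ofFn ks) :=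
      Finset.sum_nonneg fun _ _ => Finset.sum_nonneg fun _ _ => hC0 _
    linarith
  · intro w hw t ht
    have hae := ae_small ht
    have hb : ∀ l : List (Fin 7), l.length ≤ s →
        eLpNorm (fun x : ℝ × ℝ => GComp l (fun q => F (w q)) (t, x)) p volume ≤
          ENNReal.ofReal (C l) * GammaNorm s p w t := by
      intro l hl
      refine le_trans (eLpNorm_le_mul_eLpNorm_of_ae_le_mul
        (g := fun x : ℝ × ℝ => gSum s w (t, x)) (c := C l) ?_ p)
        (mul_le_mul_right (eLpNorm_gSum_le hw s p hp t) _)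
      filter_upwards [hae] with x hx
      refine (hC l hl w hw (t, x) hx).trans ?_
      exact mul_le_mul_of_nonneg_left (le_abs_self _) (hC0 l)
    have h1 : GammaNorm s p (fun q => F (w q)) t ≤ ∑ k ∈ Finset.range (s + 1),
        ∑ ks : Fin k → Fin 7, ENNReal.ofReal (C (List.ofFn ks)) * GammaNorm s p w t := by
      refine Finset.sum_le_sum fun k hk => Finset.sum_le_sum fun ks _ => hb _ ?_
      have := Finset.mem_range.1 hk
      rw [List.length_ofFn]
      omega
    refine h1.trans ?_
    simp_rw [← Finset.sum_mul]
    refine mul_le_mul_left ?_ _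
    have h2 : ∑ k ∈ Finset.range (s + 1), ∑ ks : Fin k → Fin 7, ENNReal.ofReal (C (List.ofFn ks))
        = ENNReal.ofReal (∑ k ∈ Finset.range (s + 1), ∑ ks : Fin k → Fin 7, C (List.ofFn ks)) := by
      rw [ENNReal.ofReal_sum_of_nonneg fun _ _ => Finset.sum_nonneg fun _ _ => hC0 _]
      refine Finset.sum_congr rfl fun k _ => ?_
      rw [ENNReal.ofReal_sum_of_nonneg fun _ _ => hC0 _]
    rw [h2]
    exact ENNReal.ofReal_le_ofReal (by linarith)
end
end

section
/- Let n ≥ 2 be an integer and ρ > 0. There exists a constant C_ρ > 0, depending only on n and ρ, such that for every t ≥ 0 and every compactly supported smooth function v : ℝⁿ → ℝ with supp v ⊂ {x : |x| ≤ t + ρ}, ( ∫_{ℝⁿ} |v(x)|² / (ρ + |t − |x||)² dx )^{1/2} ≤ C_ρ ‖∇v‖_{L²(ℝⁿ)}. -/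
open MeasureTheory

noncomputable section

lemma hardy_pt (n : ℕ) (hn : 2 ≤ n) (ρ t r a v D d : ℝ) (hρ : 0 < ρ) (ht : 0 ≤ t) (hr : 0 ≤ r)
    (hrt : r ≤ t + ρ) (w : ℝ) (hw : w = ((t+2*ρ)^2 - r^2)⁻¹) (hd : 0 ≤ d) (ha : |a| ≤ d * r)
    (hD : D = 4 * v * w * a + v^2 * (2 * n * w + 4 * r^2 * w^2)) :
    (v / (ρ + |t - r|))^2 ≤ 8 * D + 16 * d^2 := by
  set R := t + 2 * ρ with hR
  have hn' : (2:ℝ) ≤ n := by exact_mod_cast hn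
  have hq : 0 < R^2 - r^2 := by nlinarith
  have hw0 : 0 < w := by rw [hw]; positivity
  have hwq : w * (R^2 - r^2) = 1 := by rw [hw]; field_simp
  have hRp : 0 < R := by linarith
  -- weight
  have hb : 0 < ρ + |t - r| := by positivity
  have h1 : 1 / (ρ + |t - r|) ≤ 2 * (2 * R * w) := by
    rw [div_le_iff₀ hb]
    have h2 : R - r ≤ 2 * (ρ + |t - r|) := by
      have := le_abs_self (t-r); have := abs_nonneg (t-r); linarith
    have h3 : 1 ≤ 2 * R * w * (R - r) := by
      have : w * (R^2-r^2) ≤ 2 * R * w * (R - r) := by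
        have : w * (R^2-r^2) = (w * (R - r)) * (R + r) := by ring
        rw [this]
        have h4 : 0 ≤ w * (R - r) := mul_nonneg hw0.le (by linarith)
        nlinarith
      linarith
    have h5 : 2 * R * w * (R - r) ≤ 2 * R * w * (2 * (ρ + |t - r|)) :=
      mul_le_mul_of_nonneg_left h2 (by positivity)
    linarith
  have h2 : (v / (ρ + |t - r|))^2 ≤ 4 * (2 * R * w * v)^2 := by
    have : (v / (ρ + |t - r|))^2 = v^2 * (1 / (ρ + |t - r|))^2 := by ring
    rw [this]
    have h3 : (1 / (ρ + |t - r|))^2 ≤ (2 * (2 * R * w))^2 :=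
      pow_le_pow_left₀ (by positivity) h1 2
    nlinarith [mul_le_mul_of_nonneg_left h3 (sq_nonneg v)]
  have h3 : 4 * R^2 * w^2 ≤ 2 * n * w + 4 * r^2 * w^2 := by
    have : 4 * R^2 * w^2 - 4 * r^2 * w^2 = 4 * w := by linear_combination 4 * w * hwq
    nlinarith
  have h4 : (2 * R * w * v)^2 ≤ v^2 * (2 * n * w + 4 * r^2 * w^2) := by
    nlinarith [mul_le_mul_of_nonneg_left h3 (sq_nonneg v)]
  have h5 : |4 * v * w * a| ≤ 2 * (2 * R * w * |v|) * d := by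
    rw [abs_mul, abs_mul, abs_mul, abs_of_pos hw0, abs_of_pos (by norm_num : (0:ℝ) < 4)]
    have : |a| ≤ d * R := ha.trans (mul_le_mul_of_nonneg_left (by linarith) hd)
    have := mul_le_mul_of_nonneg_left this (by positivity : 0 ≤ 4 * |v| * w)
    linarith
  have h6 : (2 * R * w * |v|)^2 = (2 * R * w * v)^2 := by
    rw [mul_pow, sq_abs, ← mul_pow]
  have h7 := neg_abs_le (4 * v * w * a)
  nlinarith [sq_nonneg (2 * R * w * |v| - 2 * d)]

abbrev E (n : ℕ) := EuclideanSpace ℝ (Fin n)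

def wt {n : ℕ} (t ρ : ℝ) (x : E n) : ℝ := (max ((t+2*ρ)^2 - ‖x‖^2) (ρ^2))⁻¹

lemma wt_cont {n : ℕ} (t ρ : ℝ) (hρ : 0 < ρ) : Continuous (wt t ρ : E n → ℝ) := by
  unfold wt
  refine Continuous.inv₀ (by fun_prop) (fun x => ?_)
  have : 0 < ρ^2 := by positivity
  exact (lt_max_of_lt_right this).ne'

lemma wt_gt {n : ℕ} (t ρ : ℝ) (hρ : 0 < ρ) (ht : 0 ≤ t) (x : E n) (hx : ‖x‖ ≤ t + ρ) :
    ρ^2 < (t+2*ρ)^2 - ‖x‖^2 := by nlinarith [norm_nonneg x]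

lemma wt_deriv {n : ℕ} (t ρ : ℝ) (hρ : 0 < ρ) (ht : 0 ≤ t) (x : E n) (hx : ‖x‖ ≤ t + ρ) (i : Fin n) :
    HasLineDerivAt ℝ (wt t ρ) (2 * x i * (wt t ρ x)^2) x (EuclideanSpace.single i 1) := by
  have h0 := wt_gt t ρ hρ ht x hx
  have hpos : 0 < (t+2*ρ)^2 - ‖x‖^2 := lt_trans (by positivity) h0
  have he : (wt t ρ : E n → ℝ) =ᶠ[nhds x] fun y => ((t+2*ρ)^2 - ‖y‖^2)⁻¹ := by
    have : ∀ᶠ y in nhds x, ρ^2 < (t+2*ρ)^2 - ‖y‖^2 := by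
      apply (isOpen_lt continuous_const (by fun_prop)).mem_nhds h0
    filter_upwards [this] with y hy
    rw [wt, max_eq_left hy.le]
  have hn : HasFDerivAt (fun y : E n => ‖y‖^2) (2 • innerSL ℝ x) x :=
    (hasStrictFDerivAt_norm_sq x).hasFDerivAt
  have h1 := ((hn.const_sub ((t+2*ρ)^2)).hasLineDerivAt (EuclideanSpace.single i 1))
  have h2 : HasLineDerivAt ℝ (fun y : E n => ((t+2*ρ)^2 - ‖y‖^2)⁻¹) _ x (EuclideanSpace.single i 1) :=
    HasDerivAt.inv h1 (by simpa using hpos.ne')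
  have h3 := (he.symm.hasLineDerivAt_iff).1 h2
  refine HasDerivAt.congr_deriv h3 ?_
  rw [he.eq_of_nhds]
  simp [EuclideanSpace.inner_single_right]
  try ring

def G {n : ℕ} (t ρ : ℝ) (v : E n → ℝ) (i : Fin n) (x : E n) : ℝ :=
  (v x)^2 * (2 * x i * wt t ρ x)

def DG {n : ℕ} (t ρ : ℝ) (v : E n → ℝ) (i : Fin n) (x : E n) : ℝ :=
  v x * (4 * fderiv ℝ v x (EuclideanSpace.single i 1) * (x i * wt t ρ x)
    + v x * (2 * wt t ρ x + 4 * (x i)^2 * (wt t ρ x)^2))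

lemma G_deriv {n : ℕ} (t ρ : ℝ) (hρ : 0 < ρ) (ht : 0 ≤ t) (v : E n → ℝ)
    (hv : ContDiff ℝ (⊤ : ℕ∞) v) (hs : tsupport v ⊆ {x : E n | ‖x‖ ≤ t + ρ}) (i : Fin n) (x : E n) :
    HasLineDerivAt ℝ (G t ρ v i) (DG t ρ v i x) x (EuclideanSpace.single i 1) := by
  by_cases hx : x ∈ tsupport v
  · have hw := wt_deriv t ρ hρ ht x (hs hx) i
    have hv1 := ((hv.differentiable (by simp)) x).hasFDerivAt.hasLineDerivAt (EuclideanSpace.single i 1)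
    have hc : HasLineDerivAt ℝ (fun y : E n => y i) 1 x (EuclideanSpace.single i 1) := by
      have := (EuclideanSpace.proj (𝕜 := ℝ) i : E n →L[ℝ] ℝ).hasFDerivAt (x := x) |>.hasLineDerivAt (EuclideanSpace.single i 1)
      simpa using this
    have h := (HasDerivAt.pow hv1 2).mul (HasDerivAt.mul (HasDerivAt.const_mul 2 hc) hw)
    refine HasDerivAt.congr_deriv h ?_
    simp [DG]
    ring
  · have h0 : v =ᶠ[nhds x] 0 := notMem_tsupport_iff_eventuallyEq.1 hx
    have hG : (fun _ => 0) =ᶠ[nhds x] G t ρ v i := by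
      filter_upwards [h0] with y hy
      simp [G, hy]
    have : DG t ρ v i x = 0 := by simp [DG, h0.eq_of_nhds]
    rw [this]
    refine (hG.hasLineDerivAt_iff).1 ?_
    exact hasDerivAt_const _ _

lemma G_cont {n : ℕ} (t ρ : ℝ) (hρ : 0 < ρ) (v : E n → ℝ)
    (hv : ContDiff ℝ (⊤ : ℕ∞) v) (i : Fin n) : Continuous (G t ρ v i) := by
  have := wt_cont (n := n) t ρ hρ
  have := hv.continuous
  unfold G
  fun_prop

lemma DG_cont {n : ℕ} (t ρ : ℝ) (hρ : 0 < ρ) (v : E n → ℝ)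
    (hv : ContDiff ℝ (⊤ : ℕ∞) v) (i : Fin n) : Continuous (DG t ρ v i) := by
  have := wt_cont (n := n) t ρ hρ
  have := hv.continuous
  have := hv.continuous_fderiv (by simp)
  unfold DG
  fun_prop

lemma DG_int {n : ℕ} (t ρ : ℝ) (hρ : 0 < ρ) (v : E n → ℝ)
    (hv : ContDiff ℝ (⊤ : ℕ∞) v) (hc : HasCompactSupport v) (i : Fin n) : Integrable (DG t ρ v i) :=
  (DG_cont t ρ hρ v hv i).integrable_of_hasCompactSupport (HasCompactSupport.mul_right hc)

lemma G_int {n : ℕ} (t ρ : ℝ) (hρ : 0 < ρ) (v : E n → ℝ)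
    (hv : ContDiff ℝ (⊤ : ℕ∞) v) (hc : HasCompactSupport v) (i : Fin n) : Integrable (G t ρ v i) := by
  refine (G_cont t ρ hρ v hv i).integrable_of_hasCompactSupport ?_
  refine HasCompactSupport.mul_right ?_
  exact hc.comp_left (g := fun y => y^2) (by simp)

lemma DG_zero {n : ℕ} (t ρ : ℝ) (hρ : 0 < ρ) (ht : 0 ≤ t) (v : E n → ℝ)
    (hv : ContDiff ℝ (⊤ : ℕ∞) v) (hc : HasCompactSupport v)
    (hs : tsupport v ⊆ {x : E n | ‖x‖ ≤ t + ρ}) (i : Fin n) :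
    ∫ x, DG t ρ v i x = 0 := by
  have := integral_bilinear_hasLineDerivAt_right_eq_neg_left_of_integrable (μ := volume)
    (f := fun _ : E n => (1:ℝ)) (f' := fun _ => 0) (g := G t ρ v i) (g' := DG t ρ v i)
    (v := EuclideanSpace.single i 1) (B := ContinuousLinearMap.mul ℝ ℝ) (by simp)
    (by simpa using DG_int t ρ hρ v hv hc i) (by simpa using G_int t ρ hρ v hv hc i)
    (fun x _ => hasDerivAt_const _ _) (fun x _ => G_deriv t ρ hρ ht v hv hs i x)
  simpa using this

lemma DG_sum {n : ℕ} (t ρ : ℝ) (v : E n → ℝ) (x : E n) :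
    ∑ i, DG t ρ v i x = 4 * v x * wt t ρ x * fderiv ℝ v x x
      + (v x)^2 * (2 * n * wt t ρ x + 4 * ‖x‖^2 * (wt t ρ x)^2) := by
  have h1 : fderiv ℝ v x x = ∑ i, x i * fderiv ℝ v x (EuclideanSpace.single i 1) := by
    generalize fderiv ℝ v x = L
    conv_lhs => rw [← (EuclideanSpace.basisFun (Fin n) ℝ).sum_repr x]
    rw [map_sum]
    refine Finset.sum_congr rfl fun i _ => ?_
    rw [map_smul]
    simp
  have h2 : ‖x‖^2 = ∑ i, (x i)^2 := EuclideanSpace.real_norm_sq_eq x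
  rw [h1, h2]
  have h3 : (2 * n * wt t ρ x : ℝ) = ∑ i : Fin n, 2 * wt t ρ x := by simp; ring
  rw [h3, Finset.mul_sum, Finset.mul_sum, Finset.sum_mul, ← Finset.sum_add_distrib, Finset.mul_sum,
    ← Finset.sum_add_distrib]
  refine Finset.sum_congr rfl fun i _ => ?_
  rw [DG]; ring

/-- Hardy-type inequality: for `n ≥ 2` and `ρ > 0` there is `C_ρ > 0` such that for every
`t ≥ 0` and every compactly supported smooth `v : ℝⁿ → ℝ` with `supp v ⊆ {|x| ≤ t + ρ}`,
`(∫ |v(x)|²/(ρ + |t − |x||)² dx)^{1/2} ≤ C_ρ ‖∇v‖_{L²}`. -/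
theorem stmt_18 (n : ℕ) (hn : 2 ≤ n) (ρ : ℝ) (hρ : 0 < ρ) :
    ∃ C > (0:ℝ), ∀ t : ℝ, 0 ≤ t → ∀ v : EuclideanSpace ℝ (Fin n) → ℝ,
      ContDiff ℝ (⊤ : ℕ∞) v → HasCompactSupport v →
      tsupport v ⊆ {x : EuclideanSpace ℝ (Fin n) | ‖x‖ ≤ t + ρ} →
      eLpNorm (fun x : EuclideanSpace ℝ (Fin n) => v x / (ρ + |t - ‖x‖|)) 2 volume ≤
        ENNReal.ofReal C * eLpNorm (fun x => ‖fderiv ℝ v x‖) 2 volume := by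
  refine ⟨4, by norm_num, fun t ht v hv hc hs => ?_⟩
  have hd := hv.continuous_fderiv (by simp)
  have hf : Continuous (fun x : E n => v x / (ρ + |t - ‖x‖|)) := by
    refine hv.continuous.div (by fun_prop) (fun x => by positivity)
  have m1 : MemLp (fun x : E n => v x / (ρ + |t - ‖x‖|)) 2 volume := by
    refine hf.memLp_of_hasCompactSupport ?_
    simp only [div_eq_mul_inv]
    exact HasCompactSupport.mul_right hc
  have m2 : MemLp (fun x : E n => ‖fderiv ℝ v x‖) 2 volume :=
    hd.norm.memLp_of_hasCompactSupport (hc.fderiv ℝ).norm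
  have key : ∫ x : E n, (v x / (ρ + |t - ‖x‖|))^2 ≤ 16 * ∫ x, ‖fderiv ℝ v x‖^2 := by
    have hi : Integrable (fun x => ∑ i, DG t ρ v i x) :=
      integrable_finsetSum _ fun i _ => DG_int t ρ hρ v hv hc i
    calc _ ≤ ∫ x : E n, (8 * (∑ i, DG t ρ v i x) + 16 * ‖fderiv ℝ v x‖^2) := by
          refine integral_mono m1.integrable_sq ((hi.const_mul 8).add (m2.integrable_sq.const_mul 16)) ?_
          intro x
          by_cases hx : x ∈ tsupport v
          · refine hardy_pt n hn ρ t ‖x‖ (fderiv ℝ v x x) (v x) _ ‖fderiv ℝ v x‖ hρ ht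
              (norm_nonneg _) (hs hx) (wt t ρ x) ?_ (norm_nonneg _) ?_ (DG_sum t ρ v x)
            · rw [wt, max_eq_left (wt_gt t ρ hρ ht x (hs hx)).le]
            · exact (fderiv ℝ v x).le_opNorm x
          · have : v x = 0 := image_eq_zero_of_notMem_tsupport hx
            simp [DG, this]
      _ = _ := by
          rw [integral_add (hi.const_mul 8) (m2.integrable_sq.const_mul 16), integral_const_mul,
            integral_const_mul, integral_finsetSum _ fun i _ => DG_int t ρ hρ v hv hc i]
          simp [DG_zero t ρ hρ ht v hv hc hs]
  rw [m1.eLpNorm_eq_integral_rpow_norm (by norm_num) (by norm_num),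
    m2.eLpNorm_eq_integral_rpow_norm (by norm_num) (by norm_num), ← ENNReal.ofReal_mul (by norm_num)]
  apply ENNReal.ofReal_le_ofReal
  simp only [ENNReal.toReal_ofNat, Real.rpow_two, Real.norm_eq_abs, sq_abs]
  rw [← one_div, ← Real.sqrt_eq_rpow, ← Real.sqrt_eq_rpow]
  refine Real.sqrt_le_iff.2 ⟨by positivity, ?_⟩
  rw [mul_pow, Real.sq_sqrt (by positivity)]
  linarith
end
end

section
/- Let n ≥ 2 be an integer and ρ > 0. There exists a constant C_ρ > 0, depending only on n and ρ, such that the following holds. Let v, w : ℝ × ℝⁿ → ℝ be smooth functions whose supports are contained in the cone {(t,x) : |x| ≤ t + ρ}. Then for every t ≥ 0, ‖ v(t,·) · ∂w(t,·) ‖_{L²(ℝⁿ)} ≤ C_ρ ‖∇_x v(t,·)‖_{L²(ℝⁿ)} · sup_{x ∈ ℝⁿ} |Γ w(t,x)|, where ∂w denotes any one of the first-order space-time derivatives ∂_t w, ∂₁ w, …, ∂_n w, and |Γ w(t,x)| denotes the sum of the absolute values at (t,x) of ∂_α w (0 ≤ α ≤ n), Ω_{ij} w (1 ≤ i < j ≤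 n), L₀ w, and L_i w (1 ≤ i ≤ n). -/
open MeasureTheory ENNReal

noncomputable section

/-- The time derivative `∂ₜ` on `ℝ × ℝⁿ`. -/
def wdt (n : ℕ) (u : ℝ × EuclideanSpace ℝ (Fin n) → ℝ) : ℝ × EuclideanSpace ℝ (Fin n) → ℝ :=
  fun p => fderiv ℝ u p ((1:ℝ), 0)

/-- The spatial derivative `∂ᵢ` on `ℝ × ℝⁿ`. -/
def wdi (n : ℕ) (i : Fin n) (u : ℝ × EuclideanSpace ℝ (Fin n) → ℝ) :
    ℝ × EuclideanSpace ℝ (Fin n) → ℝ :=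
  fun p => fderiv ℝ u p ((0:ℝ), EuclideanSpace.single i 1)

/-- The rotation `Ω_{ij} = xᵢ∂ⱼ − xⱼ∂ᵢ`. -/
def wOm (n : ℕ) (i j : Fin n) (u : ℝ × EuclideanSpace ℝ (Fin n) → ℝ) :
    ℝ × EuclideanSpace ℝ (Fin n) → ℝ :=
  fun p => p.2 i * wdi n j u p - p.2 j * wdi n i u p

/-- The scaling field `L₀ = t∂ₜ + Σᵢ xᵢ∂ᵢ`. -/
def wL0 (n : ℕ) (u : ℝ × EuclideanSpace ℝ (Fin n) → ℝ) : ℝ × EuclideanSpace ℝ (Fin n) → ℝ :=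
  fun p => p.1 * wdt n u p + ∑ i, p.2 i * wdi n i u p

/-- The Lorentz boost `Lᵢ = t∂ᵢ + xᵢ∂ₜ`. -/
def wLi (n : ℕ) (i : Fin n) (u : ℝ × EuclideanSpace ℝ (Fin n) → ℝ) :
    ℝ × EuclideanSpace ℝ (Fin n) → ℝ :=
  fun p => p.1 * wdi n i u p + p.2 i * wdt n u p

/-- The first-order space-time derivatives `∂_α`, `0 ≤ α ≤ n`, with `∂_0 = ∂ₜ`. -/
def wpd (n : ℕ) : Fin (n + 1) → (ℝ × EuclideanSpace ℝ (Fin n) → ℝ) →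
    ℝ × EuclideanSpace ℝ (Fin n) → ℝ :=
  Fin.cases (wdt n) (fun i => wdi n i)

/-- The pointwise quantity `|Γw(t,x)|`: the sum of the absolute values of all the
Klainerman vector fields applied to `w`. -/
def wGammaAbs (n : ℕ) (w : ℝ × EuclideanSpace ℝ (Fin n) → ℝ)
    (p : ℝ × EuclideanSpace ℝ (Fin n)) : ℝ :=
  |wdt n w p| + (∑ i, |wdi n i w p|)
    + (∑ i, ∑ j, if i < j then |wOm n i j w p| else 0)
    + |wL0 n w p| + ∑ i, |wLi n i w p|

lemma euler_int {n : ℕ} (H : EuclideanSpace ℝ (Fin n) → ℝ) (hH : ContDiff ℝ 1 H)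
    (hc : HasCompactSupport H) :
    ∫ x, (fderiv ℝ H x x + n * H x) = 0 := by
  have hcont : Continuous H := hH.continuous
  have hdc : Continuous (fderiv ℝ H) := hH.continuous_fderiv (by norm_num)
  have hfc : HasCompactSupport (fderiv ℝ H) := hc.fderiv (𝕜 := ℝ)
  have key : ∀ i : Fin n, ∫ x : EuclideanSpace ℝ (Fin n),
      (x i * fderiv ℝ H x (EuclideanSpace.single i 1) + H x) = 0 := by
    intro i
    have hd : ∀ x : EuclideanSpace ℝ (Fin n), HasFDerivAt
        (fun y : EuclideanSpace ℝ (Fin n) => y i) (EuclideanSpace.proj (𝕜 := ℝ) i : EuclideanSpace ℝ (Fin n) →L[ℝ] ℝ) x :=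
      fun x => (EuclideanSpace.proj (𝕜 := ℝ) i : EuclideanSpace ℝ (Fin n) →L[ℝ] ℝ).hasFDerivAt
    have i1 : Integrable (fun x : EuclideanSpace ℝ (Fin n) =>
        x i * fderiv ℝ H x (EuclideanSpace.single i 1)) := by
      apply Continuous.integrable_of_hasCompactSupport
      · fun_prop
      · apply hfc.mono'
        intro x hx
        apply subset_tsupport
        intro h0
        apply hx
        simp [h0]
    have i2 : Integrable H := hcont.integrable_of_hasCompactSupport hc
    have := integral_mul_fderiv_eq_neg_fderiv_mul_of_integrable (μ := volume)
      (f := fun y : EuclideanSpace ℝ (Fin n) => y i) (g := H) (v := EuclideanSpace.single i 1)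
      (by simpa [(hd _).fderiv] using i2) i1
      (by
        apply Continuous.integrable_of_hasCompactSupport
        · fun_prop
        · exact hc.mul_left)
      (fun x _ => (hd x).differentiableAt) (fun x _ => hH.differentiable (by norm_num) x)
    rw [integral_add i1 i2, this]
    simp [(hd _).fderiv]
  have e : ∀ x : EuclideanSpace ℝ (Fin n), fderiv ℝ H x x + n * H x
      = ∑ i, (x i * fderiv ℝ H x (EuclideanSpace.single i 1) + H x) := by
    intro x
    rw [Finset.sum_add_distrib]
    simp only [Finset.sum_const, Finset.card_univ, Fintype.card_fin, nsmul_eq_mul]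
    congr 1
    have hx := (EuclideanSpace.basisFun (Fin n) ℝ).sum_repr x
    have h2 := congrArg (fderiv ℝ H x) hx
    rw [← h2, map_sum]
    simp
  simp_rw [e]
  rw [integral_finsetSum]
  · simp [key]
  · intro i _
    apply Continuous.integrable_of_hasCompactSupport
    · fun_prop
    · apply HasCompactSupport.add
      · apply hfc.mono'
        intro x hx
        apply subset_tsupport
        intro h0
        apply hx
        simp [h0]
      · exact hc

lemma hardy {n : ℕ} (hn : 2 ≤ n) (u : EuclideanSpace ℝ (Fin n) → ℝ) (hu : ContDiff ℝ 1 u)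
    (a R : ℝ) (ha : 0 ≤ a) (haR : a < R) (hs : ∀ x, a < ‖x‖ → u x = 0) :
    ∫⁻ x, ENNReal.ofReal ((R * (u x * (R ^ 2 - ‖x‖ ^ 2)⁻¹)) ^ 2) ≤
      ∫⁻ x, ENNReal.ofReal (‖fderiv ℝ u x‖ ^ 2) := by
  set q : EuclideanSpace ℝ (Fin n) → ℝ := fun x => u x * (R ^ 2 - ‖x‖ ^ 2)⁻¹ with hq
  have hR : 0 < R := by linarith
  have hq0 : ∀ x, a < ‖x‖ → q x = 0 := fun x hx => by simp [hq, hs x hx]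
  have hqC : ContDiff ℝ 1 q := by
    rw [contDiff_iff_contDiffAt]
    intro x
    rcases lt_or_ge ‖x‖ R with h | h
    · apply ContDiffAt.mul hu.contDiffAt
      apply ContDiffAt.inv
      · exact contDiffAt_const.sub (contDiff_norm_sq ℝ).contDiffAt
      · nlinarith [norm_nonneg x]
    · have : q =ᶠ[nhds x] fun _ => 0 := by
        have : ∀ᶠ y in nhds x, a < ‖y‖ :=
          continuous_norm.continuousAt.eventually (lt_mem_nhds (by linarith))
        filter_upwards [this] with y hy using hq0 y hy
      exact contDiffAt_const.congr_of_eventuallyEq this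
  have hcs : ∀ f : EuclideanSpace ℝ (Fin n) → ℝ, (∀ x, a < ‖x‖ → f x = 0) →
      HasCompactSupport f := by
    intro f hf
    apply HasCompactSupport.intro (isCompact_closedBall 0 a)
    intro x hx
    exact hf x (by simpa using hx)
  have huq : ∀ x, u x = q x * (R ^ 2 - ‖x‖ ^ 2) := by
    intro x
    rcases lt_or_ge ‖x‖ R with h | h
    · have : R ^ 2 - ‖x‖ ^ 2 ≠ 0 := by nlinarith [norm_nonneg x]
      simp only [hq]; field_simp
    · simp [hq, hs x (by linarith)]
  have hqd : Differentiable ℝ q := hqC.differentiable (by norm_num)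
  have hud : Differentiable ℝ u := hu.differentiable (by norm_num)
  have hE := euler_int (fun x => q x * u x) (hqC.mul hu)
    (hcs _ (fun x hx => by simp [hs x hx]))
  have hdu : ∀ x, fderiv ℝ u x x = fderiv ℝ q x x * (R ^ 2 - ‖x‖ ^ 2) - 2 * ‖x‖ ^ 2 * q x := by
    intro x
    have h1 : HasFDerivAt (fun y : EuclideanSpace ℝ (Fin n) => R ^ 2 - ‖y‖ ^ 2)
        (-(2 • (innerSL ℝ x))) x := (hasStrictFDerivAt_norm_sq x).hasFDerivAt.const_sub _
    have h2 := (hqd x).hasFDerivAt.mul h1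
    have h4 : HasFDerivAt u _ x := h2.congr_of_eventuallyEq (Filter.Eventually.of_forall huq)
    rw [h4.fderiv]
    simp
    ring
  have hdH : ∀ x, fderiv ℝ (fun x => q x * u x) x x = q x * fderiv ℝ u x x
      + u x * fderiv ℝ q x x := by
    intro x
    have h := ((hqd x).hasFDerivAt.mul (hud x).hasFDerivAt).fderiv
    have h' : fderiv ℝ (fun x => q x * u x) x = _ := h
    rw [h']
    simp
  have hcu : Continuous (fderiv ℝ u) := hu.continuous_fderiv (by norm_num)
  have hcuc : HasCompactSupport (fderiv ℝ u) := (hcs u hs).fderiv (𝕜 := ℝ)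
  have hqc := hqC.continuous
  have i1 : Integrable (fun x => (R * q x) ^ 2) := by
    apply Continuous.integrable_of_hasCompactSupport
    · fun_prop
    · exact hcs _ (fun x hx => by simp [hq0 x hx])
  have i2 : Integrable (fun x => ‖fderiv ℝ u x‖ ^ 2) := by
    apply Continuous.integrable_of_hasCompactSupport
    · fun_prop
    · apply hcuc.mono
      intro x hx h0
      apply hx
      simp [h0]
  have hHC : ContDiff ℝ 1 (fun x => q x * u x) := hqC.mul hu
  have hHs : HasCompactSupport (fun x => q x * u x) := hcs _ (fun x hx => by simp [hs x hx])
  have i3 : Integrable (fun x => fderiv ℝ (fun x => q x * u x) x x + n * (q x * u x)) := by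
    apply Continuous.integrable_of_hasCompactSupport
    · have := hHC.continuous_fderiv (by norm_num)
      have := hHC.continuous
      fun_prop
    · apply HasCompactSupport.add
      · apply (hHs.fderiv (𝕜 := ℝ)).mono
        intro x hx h0
        apply hx
        simp [h0]
      · exact hHs.mul_left
  have hpt : ∀ x, (R * q x) ^ 2 - ‖fderiv ℝ u x‖ ^ 2 ≤
      fderiv ℝ (fun x => q x * u x) x x + n * (q x * u x) := by
    intro x
    rcases lt_or_ge ‖x‖ R with h | h
    · have h1 : |fderiv ℝ u x x| ≤ ‖fderiv ℝ u x‖ * R := by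
        refine ((fderiv ℝ u x).le_opNorm x).trans ?_
        gcongr
      have h2 : -(|q x| * (‖fderiv ℝ u x‖ * R)) ≤ q x * fderiv ℝ u x x := by
        have : |q x * fderiv ℝ u x x| ≤ |q x| * (‖fderiv ℝ u x‖ * R) := by
          rw [abs_mul]; gcongr
        linarith [neg_abs_le (q x * fderiv ℝ u x x)]
      have hn' : (2 : ℝ) ≤ n := by exact_mod_cast hn
      have h3 : 0 ≤ R ^ 2 - ‖x‖ ^ 2 := by nlinarith [norm_nonneg x]
      have h4 : 2 * (q x ^ 2 * (R ^ 2 - ‖x‖ ^ 2)) ≤ n * (q x ^ 2 * (R ^ 2 - ‖x‖ ^ 2)) := by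
        gcongr
      rw [hdH, huq x]
      have h5 : q x * (R ^ 2 - ‖x‖ ^ 2) * fderiv ℝ q x x =
        q x * fderiv ℝ u x x + 2 * ‖x‖ ^ 2 * q x ^ 2 := by rw [hdu]; ring
      rw [h5]
      have h6 : |q x| ^ 2 = q x ^ 2 := sq_abs _
      nlinarith [sq_nonneg (R * |q x| - ‖fderiv ℝ u x‖)]
    · have h0 : q x = 0 := hq0 x (by linarith)
      have h1 : u x = 0 := hs x (by linarith)
      rw [hdH, h0, h1]
      simp
  have hfin : ∫ x, (R * q x) ^ 2 ≤ ∫ x, ‖fderiv ℝ u x‖ ^ 2 := by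
    have := integral_mono (i1.sub i2) i3 hpt
    rw [hE] at this
    simp only [Pi.sub_apply] at this
    rw [integral_sub i1 i2] at this
    linarith
  rw [← ofReal_integral_eq_lintegral_ofReal i1 (by filter_upwards with x; positivity),
    ← ofReal_integral_eq_lintegral_ofReal i2 (by filter_upwards with x; positivity)]
  exact ENNReal.ofReal_le_ofReal hfin

lemma gamma_pointwise {n : ℕ} (w : ℝ × EuclideanSpace ℝ (Fin n) → ℝ) (t : ℝ) (ht : 0 ≤ t)
    (x : EuclideanSpace ℝ (Fin n)) (α : Fin (n + 1)) :
    (1 + |t - ‖x‖|) * |wpd n α w (t, x)| ≤ 3 * wGammaAbs n w (t, x) := by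
  set S := ∑ i, ∑ j, if i < j then |wOm n i j w (t, x)| else 0 with hS
  have hS0 : ∀ i : Fin n, ∀ j : Fin n, 0 ≤ if i < j then |wOm n i j w (t, x)| else 0 := by
    intro i j; split_ifs <;> positivity
  have hSn : 0 ≤ S := Finset.sum_nonneg fun i _ => Finset.sum_nonneg fun j _ => hS0 i j
  have hB : ∀ i, |wdi n i w (t, x)| ≤ ∑ i, |wdi n i w (t, x)| := fun i =>
    Finset.single_le_sum (f := fun i => |wdi n i w (t, x)|) (fun i _ => abs_nonneg _)
      (Finset.mem_univ i)
  have hL : ∀ i, |wLi n i w (t, x)| ≤ ∑ i, |wLi n i w (t, x)| := fun i =>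
    Finset.single_le_sum (f := fun i => |wLi n i w (t, x)|) (fun i _ => abs_nonneg _)
      (Finset.mem_univ i)
  have hBn : 0 ≤ ∑ i, |wdi n i w (t, x)| := Finset.sum_nonneg fun i _ => abs_nonneg _
  have hLn : 0 ≤ ∑ i, |wLi n i w (t, x)| := Finset.sum_nonneg fun i _ => abs_nonneg _
  have hO : ∀ i, ∑ j, |wOm n i j w (t, x)| ≤ 2 * S := by
    intro i
    have h1 : ∑ j, (if i < j then |wOm n i j w (t, x)| else 0) ≤ S :=
      Finset.single_le_sum (f := fun i => ∑ j, if i < j then |wOm n i j w (t, x)| else 0)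
        (fun i _ => Finset.sum_nonneg fun j _ => hS0 i j) (Finset.mem_univ i)
    have h2 : ∑ j, (if j < i then |wOm n j i w (t, x)| else 0) ≤ S :=
      Finset.sum_le_sum fun j _ => Finset.single_le_sum
        (f := fun k => if j < k then |wOm n j k w (t, x)| else 0)
        (fun k _ => hS0 j k) (Finset.mem_univ i)
    have h3 : ∑ j, |wOm n i j w (t, x)| ≤ ∑ j, ((if i < j then |wOm n i j w (t, x)| else 0)
        + (if j < i then |wOm n j i w (t, x)| else 0)) := by
      apply Finset.sum_le_sum
      intro j _
      rcases lt_trichotomy i j with h | h | h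
      · simp [h, h.not_gt]
      · subst h; simp [wOm]
      · have : |wOm n i j w (t, x)| = |wOm n j i w (t, x)| := by
          rw [← abs_neg]; congr 1; simp only [wOm]; ring
        simp [h, h.not_gt, this]
    rw [Finset.sum_add_distrib] at h3
    linarith
  have hr : 0 ≤ ‖x‖ := norm_nonneg x
  have hxi : ∀ i, |x i| ≤ ‖x‖ := fun i => by simpa using PiLp.norm_apply_le x i
  have hr2 : ∑ i, x i * x i = ‖x‖ ^ 2 := by
    rw [EuclideanSpace.real_norm_sq_eq]; simp [sq]
  have hsum : ∀ f : Fin n → ℝ, |∑ i, x i * f i| ≤ ‖x‖ * ∑ i, |f i| := by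
    intro f
    refine (Finset.abs_sum_le_sum_abs _ _).trans ?_
    rw [Finset.mul_sum]
    apply Finset.sum_le_sum
    intro i _
    rw [abs_mul]
    exact mul_le_mul_of_nonneg_right (hxi i) (abs_nonneg _)
  have hG : wGammaAbs n w (t, x) = |wdt n w (t, x)| + (∑ i, |wdi n i w (t, x)|) + S
    + |wL0 n w (t, x)| + ∑ i, |wLi n i w (t, x)| := rfl
  set G := wGammaAbs n w (t, x)
  have hT := abs_nonneg (wdt n w (t, x))
  have h0 := abs_nonneg (wL0 n w (t, x))
  have hGn : 0 ≤ G := by linarith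
  have key : |wpd n α w (t, x)| ≤ G ∧
      |(t ^ 2 - ‖x‖ ^ 2) * wpd n α w (t, x)| ≤ (t + ‖x‖) * (2 * G) := by
    refine Fin.cases ?_ (fun i => ?_) α
    · change |wdt n w (t, x)| ≤ G ∧ |(t ^ 2 - ‖x‖ ^ 2) * wdt n w (t, x)| ≤ _
      refine ⟨by linarith, ?_⟩
      have e : (t ^ 2 - ‖x‖ ^ 2) * wdt n w (t, x)
          = t * wL0 n w (t, x) - ∑ i, x i * wLi n i w (t, x) := by
        have : ∑ i, x i * wLi n i w (t, x) =
            t * (∑ i, x i * wdi n i w (t, x)) + (∑ i, x i * x i) * wdt n w (t, x) := by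
          rw [Finset.mul_sum, Finset.sum_mul, ← Finset.sum_add_distrib]
          apply Finset.sum_congr rfl
          intro i _
          simp only [wLi]; ring
        rw [this, hr2]
        simp only [wL0]; ring
      rw [e]
      refine (abs_sub _ _).trans ?_
      rw [abs_mul, abs_of_nonneg ht]
      have h1 := hsum (fun i => wLi n i w (t, x))
      have h2 : t * |wL0 n w (t, x)| ≤ t * (2 * G) := by gcongr; linarith
      have h3 : ‖x‖ * ∑ i, |wLi n i w (t, x)| ≤ ‖x‖ * (2 * G) := by gcongr; linarith
      linarith
    · change |wdi n i w (t, x)| ≤ G ∧ |(t ^ 2 - ‖x‖ ^ 2) * wdi n i w (t, x)| ≤ _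
      refine ⟨by linarith [hB i], ?_⟩
      have e : (t ^ 2 - ‖x‖ ^ 2) * wdi n i w (t, x)
          = t * wLi n i w (t, x) - x i * wL0 n w (t, x) + ∑ j, x j * wOm n i j w (t, x) := by
        have : ∑ j, x j * wOm n i j w (t, x) =
            x i * (∑ i, x i * wdi n i w (t, x)) - (∑ i, x i * x i) * wdi n i w (t, x) := by
          rw [Finset.mul_sum, Finset.sum_mul, ← Finset.sum_sub_distrib]
          apply Finset.sum_congr rfl
          intro i _
          simp only [wOm]; ring
        rw [this, hr2]
        simp only [wL0, wLi]; ring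
      rw [e]
      refine (abs_add_le _ _).trans ?_
      have h4 := abs_sub (t * wLi n i w (t, x)) (x i * wL0 n w (t, x))
      rw [abs_mul, abs_mul, abs_of_nonneg ht] at h4
      have h1 := hsum (fun j => wOm n i j w (t, x))
      have h2 : t * |wLi n i w (t, x)| ≤ t * (2 * G) := by gcongr; linarith [hL i]
      have h5 : |x i| * |wL0 n w (t, x)| ≤ ‖x‖ * |wL0 n w (t, x)| := by gcongr; exact hxi i
      have h3 : ‖x‖ * (|wL0 n w (t, x)| + ∑ j, |wOm n i j w (t, x)|) ≤ ‖x‖ * (2 * G) := by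
        gcongr; linarith [hO i]
      linarith
  obtain ⟨k1, k2⟩ := key
  have k3 : |t - ‖x‖| * |wpd n α w (t, x)| ≤ 2 * G := by
    rcases (add_nonneg ht hr).eq_or_lt with h | h
    · have : t - ‖x‖ = 0 := by linarith
      rw [this]; simp; linarith
    · have e : t ^ 2 - ‖x‖ ^ 2 = (t + ‖x‖) * (t - ‖x‖) := by ring
      rw [e, abs_mul, abs_mul, abs_of_pos h, mul_assoc] at k2
      exact le_of_mul_le_mul_left k2 h
  linarith

/-- For `n ≥ 2`, `ρ > 0` there is `C_ρ > 0` such that for all smooth `v, w` supported in the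
cone `{|x| ≤ t + ρ}`, every `t ≥ 0` and every first-order space-time derivative `∂`,
`‖v(t,·) ∂w(t,·)‖_{L²} ≤ C_ρ ‖∇ₓv(t,·)‖_{L²} · sup_x |Γw(t,x)|`. -/
theorem stmt_19 (n : ℕ) (hn : 2 ≤ n) (ρ : ℝ) (hρ : 0 < ρ) :
    ∃ C > (0:ℝ), ∀ v w : ℝ × EuclideanSpace ℝ (Fin n) → ℝ,
      ContDiff ℝ (⊤ : ℕ∞) v → ContDiff ℝ (⊤ : ℕ∞) w →
      tsupport v ⊆ {p : ℝ × EuclideanSpace ℝ (Fin n) | ‖p.2‖ ≤ p.1 + ρ} →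
      tsupport w ⊆ {p : ℝ × EuclideanSpace ℝ (Fin n) | ‖p.2‖ ≤ p.1 + ρ} →
      ∀ t : ℝ, 0 ≤ t → ∀ α : Fin (n + 1),
        eLpNorm (fun x : EuclideanSpace ℝ (Fin n) => v (t, x) * wpd n α w (t, x)) 2 volume ≤
          ENNReal.ofReal C
            * eLpNorm (fun x : EuclideanSpace ℝ (Fin n) =>
                ‖fderiv ℝ (fun y => v (t, y)) x‖) 2 volume
            * ⨆ x : EuclideanSpace ℝ (Fin n), ENNReal.ofReal (wGammaAbs n w (t, x)) := by
  refine ⟨6 * (ρ + 1), by positivity, ?_⟩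
  intro v w hv hw hsv hsw t ht α
  set u : EuclideanSpace ℝ (Fin n) → ℝ := fun y => v (t, y) with hu_def
  have hu : ContDiff ℝ 1 u := by
    have h1 : ContDiff ℝ 1 v := hv.of_le (by exact_mod_cast le_top)
    exact h1.comp (contDiff_const.prodMk contDiff_id)
  have hs : ∀ x, t + ρ < ‖x‖ → u x = 0 := by
    intro x hx
    by_contra h
    have := hsv (subset_tsupport v (show (t, x) ∈ Function.support v from h))
    simp only [Set.mem_ofPred_eq] at this
    linarith
  set R := t + ρ + 1 with hR
  have hH := hardy hn u hu (t + ρ) R (by positivity) (by linarith) hs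
  set g : EuclideanSpace ℝ (Fin n) → ℝ := fun x => R * (u x * (R ^ 2 - ‖x‖ ^ 2)⁻¹) with hg
  have hgm : Measurable g := by
    have := hu.continuous.measurable
    fun_prop
  set S := ⨆ x : EuclideanSpace ℝ (Fin n), ENNReal.ofReal (wGammaAbs n w (t, x)) with hS
  have hpt : ∀ x, ‖u x * wpd n α w (t, x)‖ₑ ≤ ENNReal.ofReal (6 * (ρ + 1)) * S * ‖g x‖ₑ := by
    intro x
    have hreal : |u x * wpd n α w (t, x)| ≤ 6 * (ρ + 1) * wGammaAbs n w (t, x) * |g x| := by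
      rcases lt_or_ge (t + ρ) ‖x‖ with h | h
      · simp [hg, hs x h]
      · have hp := gamma_pointwise w t ht x α
        have hr := norm_nonneg x
        have hpos : 0 < R ^ 2 - ‖x‖ ^ 2 := by nlinarith
        have e : R * |u x| = |g x| * (R ^ 2 - ‖x‖ ^ 2) := by
          simp only [hg]
          rw [abs_mul, abs_mul, abs_inv, abs_of_pos hpos, abs_of_pos (show 0 < R by linarith)]
          field_simp
        have b1 : R ^ 2 - ‖x‖ ^ 2 ≤ R * (2 * (ρ + 1) * (1 + |t - ‖x‖|)) := by
          have c1 : R - ‖x‖ ≤ (ρ + 1) * (1 + |t - ‖x‖|) := by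
            have := le_abs_self (t - ‖x‖)
            have := mul_nonneg hρ.le (abs_nonneg (t - ‖x‖))
            nlinarith
          have c2 : R + ‖x‖ ≤ 2 * R := by linarith
          calc R ^ 2 - ‖x‖ ^ 2 = (R + ‖x‖) * (R - ‖x‖) := by ring
            _ ≤ (2 * R) * ((ρ + 1) * (1 + |t - ‖x‖|)) := by
                apply mul_le_mul c2 c1 <;> linarith
            _ = _ := by ring
        have b2 : |u x| ≤ |g x| * (2 * (ρ + 1) * (1 + |t - ‖x‖|)) := by
          have : R * |u x| ≤ R * (|g x| * (2 * (ρ + 1) * (1 + |t - ‖x‖|))) := by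
            rw [e]
            calc _ ≤ |g x| * (R * (2 * (ρ + 1) * (1 + |t - ‖x‖|))) := by gcongr
              _ = _ := by ring
          exact le_of_mul_le_mul_left this (by linarith)
        rw [abs_mul]
        calc |u x| * |wpd n α w (t, x)|
            ≤ |g x| * (2 * (ρ + 1) * (1 + |t - ‖x‖|)) * |wpd n α w (t, x)| := by gcongr
          _ = |g x| * (2 * (ρ + 1)) * ((1 + |t - ‖x‖|) * |wpd n α w (t, x)|) := by ring
          _ ≤ |g x| * (2 * (ρ + 1)) * (3 * wGammaAbs n w (t, x)) := by gcongr
          _ = _ := by ring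
    have hSx : ENNReal.ofReal (wGammaAbs n w (t, x)) ≤ S :=
      le_iSup (fun x => ENNReal.ofReal (wGammaAbs n w (t, x))) x
    calc ‖u x * wpd n α w (t, x)‖ₑ = ENNReal.ofReal |u x * wpd n α w (t, x)| := by
          rw [← Real.norm_eq_abs, ofReal_norm]
      _ ≤ ENNReal.ofReal (6 * (ρ + 1) * wGammaAbs n w (t, x) * |g x|) :=
          ENNReal.ofReal_le_ofReal hreal
      _ = ENNReal.ofReal (6 * (ρ + 1)) * ENNReal.ofReal (wGammaAbs n w (t, x)) * ‖g x‖ₑ := by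
          rw [ENNReal.ofReal_mul' (abs_nonneg _), ENNReal.ofReal_mul (by positivity),
            ← Real.norm_eq_abs, ofReal_norm]
      _ ≤ _ := by gcongr
  have hsq : ∀ y : ℝ, ‖y‖ₑ ^ (2 : ℝ) = ENNReal.ofReal (y ^ 2) := by
    intro y
    rw [← ofReal_norm, ENNReal.ofReal_rpow_of_nonneg (norm_nonneg _) (by norm_num)]
    simp
  have hA : eLpNorm g 2 volume ≤ eLpNorm (fun x => ‖fderiv ℝ u x‖) 2 volume := by
    rw [eLpNorm_eq_lintegral_rpow_enorm_toReal two_ne_zero ENNReal.ofNat_ne_top,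
      eLpNorm_eq_lintegral_rpow_enorm_toReal two_ne_zero ENNReal.ofNat_ne_top]
    simp only [ENNReal.toReal_ofNat, hsq]
    gcongr
  have hB : eLpNorm (fun x => u x * wpd n α w (t, x)) 2 volume ≤
      ENNReal.ofReal (6 * (ρ + 1)) * S * eLpNorm g 2 volume := by
    rw [eLpNorm_eq_lintegral_rpow_enorm_toReal two_ne_zero ENNReal.ofNat_ne_top,
      eLpNorm_eq_lintegral_rpow_enorm_toReal two_ne_zero ENNReal.ofNat_ne_top]
    simp only [ENNReal.toReal_ofNat]
    set K := ENNReal.ofReal (6 * (ρ + 1)) * S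
    calc (∫⁻ x, ‖u x * wpd n α w (t, x)‖ₑ ^ (2 : ℝ)) ^ (1 / (2 : ℝ))
        ≤ (∫⁻ x, K ^ (2 : ℝ) * ‖g x‖ₑ ^ (2 : ℝ)) ^ (1 / (2 : ℝ)) := by
          gcongr with x
          rw [← ENNReal.mul_rpow_of_nonneg _ _ (by norm_num)]
          gcongr
          exact hpt x
      _ = _ := by
          rw [lintegral_const_mul _ (by fun_prop), ENNReal.mul_rpow_of_nonneg _ _ (by norm_num),
            ← ENNReal.rpow_mul]
          norm_num
  calc _ ≤ ENNReal.ofReal (6 * (ρ + 1)) * S * eLpNorm g 2 volume := hB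
    _ ≤ ENNReal.ofReal (6 * (ρ + 1)) * S * eLpNorm (fun x => ‖fderiv ℝ u x‖) 2 volume := by
        gcongr
    _ = _ := by ring
end
end
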